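/- arXiv:2008.10564 — 3 statements merged into one kernel-verified Lean document; each statement's English description precedes it below -/
import Mathlib

section
/- Let d ≥ 2 be an integer, p > 0, and let (a_n)_{n∈ℕ} be a strictly decreasing sequence of positive reals converging to 0. For n ∈ ℕ let A_{p,n} denote the number of indices k with 1 ≤ k ≤ n such that the interval ((k+1)^{-p}, k^{-p}] contains at least one term a_i of the sequence. If liminf_{n→∞} A_{p,n}/n > 0, then for every θ ∈ (0,1], lodim_θ(C^d({a_n})) ≥ lodim_θ(C_p^d). -/
open Set Metric Filter

/-- The upper θ-intermediate dimension of a set `E` in a metric space: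
the infimum of all `s ≥ 0` such that for every `ε > 0` there is `δ₀ > 0` such that for all
`0 < δ < δ₀` there is a countable cover `𝒰` of `E` with `δ ≤ diam U ≤ δ ^ θ` for all `U ∈ 𝒰`
and `∑_{U ∈ 𝒰} (diam U) ^ s ≤ ε`. -/
noncomputable def updim {X : Type*} [PseudoMetricSpace X] (θ : ℝ) (E : Set X) : ℝ :=
  sInf {s : ℝ | 0 ≤ s ∧ ∀ ε : ℝ, 0 < ε → ∃ δ₀ : ℝ, 0 < δ₀ ∧ ∀ δ : ℝ, 0 < δ → δ < δ₀ →
    ∃ 𝒰 : Set (Set X), 𝒰.Countable ∧ E ⊆ ⋃₀ 𝒰 ∧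
      (∀ U ∈ 𝒰, δ ≤ diam U ∧ diam U ≤ δ ^ θ) ∧
      ∑' U : 𝒰, ENNReal.ofReal (diam (U : Set X) ^ s) ≤ ENNReal.ofReal ε}

/-- The lower θ-intermediate dimension of a set `E` in a metric space. -/
noncomputable def lodim {X : Type*} [PseudoMetricSpace X] (θ : ℝ) (E : Set X) : ℝ :=
  sInf {s : ℝ | 0 ≤ s ∧ ∀ ε : ℝ, 0 < ε → ∀ δ₀ : ℝ, 0 < δ₀ → ∃ δ : ℝ, 0 < δ ∧ δ < δ₀ ∧
    ∃ 𝒰 : Set (Set X), 𝒰.Countable ∧ E ⊆ ⋃₀ 𝒰 ∧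
      (∀ U ∈ 𝒰, δ ≤ diam U ∧ diam U ≤ δ ^ θ) ∧
      ∑' U : 𝒰, ENNReal.ofReal (diam (U : Set X) ^ s) ≤ ENNReal.ofReal ε}

/-- `C_p^d`: the union over `n ≥ 1` of the spheres in `ℝ^d` of radius `n^{-p}` centred at
the origin. -/
noncomputable def concentric (d : ℕ) (p : ℝ) : Set (EuclideanSpace ℝ (Fin d)) :=
  {x | ∃ n : ℕ, 1 ≤ n ∧ ‖x‖ = (n : ℝ) ^ (-p)}

/-- `C^d({a_n})`: the union over `n` of the spheres in `ℝ^d` of radius `a n` centred at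
the origin. -/
noncomputable def concentricSeq (d : ℕ) (a : ℕ → ℝ) : Set (EuclideanSpace ℝ (Fin d)) :=
  {x | ∃ n : ℕ, ‖x‖ = a n}


/-- Existence of a cover with prescribed cost. -/
def Cov {X : Type*} [PseudoMetricSpace X] (θ δ s : ℝ) (E : Set X) (c : ℝ) : Prop :=
  ∃ 𝒰 : Set (Set X), 𝒰.Countable ∧ E ⊆ ⋃₀ 𝒰 ∧
      (∀ U ∈ 𝒰, δ ≤ diam U ∧ diam U ≤ δ ^ θ) ∧
      ∑' U : 𝒰, ENNReal.ofReal (diam (U : Set X) ^ s) ≤ ENNReal.ofReal c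

/-- Admissible exponents. -/
def Adm {X : Type*} [PseudoMetricSpace X] (θ s : ℝ) (E : Set X) : Prop :=
  ∀ ε : ℝ, 0 < ε → ∀ δ₀ : ℝ, 0 < δ₀ → ∃ δ : ℝ, 0 < δ ∧ δ < δ₀ ∧ Cov θ δ s E ε

lemma lodim_eq {X : Type*} [PseudoMetricSpace X] (θ : ℝ) (E : Set X) :
    lodim θ E = sInf {s : ℝ | 0 ≤ s ∧ Adm θ s E} := rfl

lemma lodim_le_of_adm {X : Type*} [PseudoMetricSpace X] {θ s : ℝ} {E : Set X} (hs : 0 ≤ s)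
    (h : Adm θ s E) : lodim θ E ≤ s := by
  rw [lodim_eq]
  exact csInf_le ⟨0, fun x hx => hx.1⟩ ⟨hs, h⟩

lemma exists_cover_of_card {X : Type*} [PseudoMetricSpace X] (F : Set X) (r B : ℝ) (hr : 0 ≤ r)
    (_hB : 0 ≤ B)
    (h : ∀ T : Finset X, (∀ x ∈ T, x ∈ F) → (∀ x ∈ T, ∀ y ∈ T, x ≠ y → r < dist x y) →
      (T.card : ℝ) ≤ B) :
    ∃ T : Finset X, (T.card : ℝ) ≤ B ∧ F ⊆ ⋃ t ∈ T, closedBall t r := by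
  classical
  let P : ℕ → Prop := fun n => ∃ T : Finset X, T.card = n ∧ (∀ x ∈ T, x ∈ F) ∧
    (∀ x ∈ T, ∀ y ∈ T, x ≠ y → r < dist x y)
  have hP0 : P 0 := ⟨∅, by simp⟩
  have hspec : P (Nat.findGreatest P ⌊B⌋₊) := Nat.findGreatest_spec (Nat.zero_le _) hP0
  obtain ⟨T, hT, hTF, hTs⟩ := hspec
  refine ⟨T, h T hTF hTs, ?_⟩
  intro x hx
  by_contra hcon
  simp only [mem_iUnion, mem_closedBall, not_exists, not_le] at hcon
  have hxT : x ∉ T := by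
    intro hxT
    have := hcon x hxT
    rw [dist_self] at this
    linarith
  have hF' : ∀ y ∈ insert x T, y ∈ F := by
    intro y hy
    rcases Finset.mem_insert.1 hy with rfl | hy
    · exact hx
    · exact hTF y hy
  have hs' : ∀ y ∈ insert x T, ∀ z ∈ insert x T, y ≠ z → r < dist y z := by
    intro y hy z hz hyz
    rcases Finset.mem_insert.1 hy with h1 | h1 <;> rcases Finset.mem_insert.1 hz with h2 | h2
    · exact absurd (h1.trans h2.symm) hyz
    · rw [h1]; exact hcon z h2
    · rw [h2, dist_comm]; exact hcon y h1
    · exact hTs y h1 z h2 hyz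
  have hc : (insert x T).card = T.card + 1 := Finset.card_insert_of_notMem hxT
  have hle : (insert x T).card ≤ ⌊B⌋₊ := Nat.le_floor (h _ hF' hs')
  have := Nat.le_findGreatest (P := P) hle (⟨insert x T, rfl, hF', hs'⟩ : P _)
  omega

lemma card_bound (d : ℕ) (hd : 2 ≤ d) (T : Finset (EuclideanSpace ℝ (Fin d))) (ρ R1 R2 : ℝ)
    (hρ : 0 < ρ) (h1 : 0 ≤ R1) (h2 : 0 ≤ R2)
    (hT : ∀ x ∈ T, R1 + ρ ≤ ‖x‖ ∧ ‖x‖ ≤ R2 - ρ) (h12 : R1 ≤ R2)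
    (hs : ∀ x ∈ T, ∀ y ∈ T, x ≠ y → 2 * ρ < dist x y) :
    (T.card : ℝ) * ρ ^ d ≤ R2 ^ d - R1 ^ d := by
  classical
  have : Nonempty (Fin d) := ⟨⟨0, by omega⟩⟩
  set μ := (MeasureTheory.volume : MeasureTheory.Measure (EuclideanSpace ℝ (Fin d)))
  have hfin : Module.finrank ℝ (EuclideanSpace ℝ (Fin d)) = d := by simp
  have hball : ∀ (x : EuclideanSpace ℝ (Fin d)) (r : ℝ), 0 ≤ r →
      μ (ball x r) = ENNReal.ofReal (r ^ d) * μ (ball 0 1) := by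
    intro x r hr
    rw [MeasureTheory.Measure.addHaar_ball μ x hr, hfin]
  have hpd : (T : Set (EuclideanSpace ℝ (Fin d))).PairwiseDisjoint (fun t => ball t ρ) := by
    intro x hx y hy hxy
    exact ball_disjoint_ball (by linarith [hs x hx y hy hxy])
  have hdis : Disjoint (⋃ t ∈ T, ball t ρ) (ball (0 : EuclideanSpace ℝ (Fin d)) R1) := by
    rw [Set.disjoint_iUnion₂_left]
    intro t ht
    refine ball_disjoint_ball ?_
    rw [dist_zero_right]; linarith [(hT t ht).1]
  have hsub : (⋃ t ∈ T, ball t ρ) ∪ ball (0 : EuclideanSpace ℝ (Fin d)) R1 ⊆ ball 0 R2 := by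
    apply Set.union_subset
    · apply Set.iUnion₂_subset
      intro t ht
      refine ball_subset_ball' ?_
      rw [dist_zero_right]; linarith [(hT t ht).2]
    · exact ball_subset_ball h12
  have hm := MeasureTheory.measure_mono (μ := μ) hsub
  rw [MeasureTheory.measure_union hdis measurableSet_ball,
    MeasureTheory.measure_biUnion_finset hpd (fun _ _ => measurableSet_ball),
    Finset.sum_congr rfl (fun t _ => hball t ρ hρ.le), hball _ _ h1, hball _ _ h2] at hm
  rw [Finset.sum_const, nsmul_eq_mul, ← mul_assoc, ← add_mul] at hm
  have hpos : μ (ball 0 1) ≠ 0 := (measure_ball_pos μ _ one_pos).ne'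
  have hne : μ (ball 0 1) ≠ ⊤ := MeasureTheory.measure_ball_lt_top.ne
  have hm2 := (ENNReal.mul_le_mul_iff_left hpos hne).1 hm
  rw [← ENNReal.ofReal_natCast, ← ENNReal.ofReal_mul (by positivity),
    ← ENNReal.ofReal_add (by positivity) (by positivity),
    ENNReal.ofReal_le_ofReal_iff (by positivity)] at hm2
  linarith

lemma pow_diff_le (m : ℕ) (u : ℝ) (hu : 1 ≤ u) :
    (u + 1) ^ (m + 1) - (u - 1) ^ (m + 1) ≤ 2 * (m + 1) * (u + 1) ^ m := by
  induction m with
  | zero => simp; linarith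
  | succ k ih =>
    have h1 : (u - 1) ^ (k + 1) ≤ (u + 1) ^ (k + 1) :=
      pow_le_pow_left₀ (by linarith) (by linarith) _
    have : (u + 1) ^ (k + 1 + 1) - (u - 1) ^ (k + 1 + 1)
        = (u + 1) * ((u + 1) ^ (k + 1) - (u - 1) ^ (k + 1)) + 2 * (u - 1) ^ (k + 1) := by ring
    rw [this]
    have h2 := mul_le_mul_of_nonneg_left ih (by linarith : 0 ≤ u + 1)
    have h3 : (u + 1) * (2 * (k + 1) * (u + 1) ^ k) = 2 * (k + 1) * (u + 1) ^ (k + 1) := by ring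
    push_cast
    nlinarith

lemma sphere_cover (d : ℕ) (hd : 2 ≤ d) (R r : ℝ) (hr : 0 < r) (hrR : r ≤ R) :
    ∃ T : Finset (EuclideanSpace ℝ (Fin d)), (T.card : ℝ) ≤ 2 * d * (5 * (R / r)) ^ (d - 1) ∧
      {x | ‖x‖ = R} ⊆ ⋃ t ∈ T, closedBall t (r / 2) := by
  have hR : 0 < R := by linarith
  refine exists_cover_of_card _ _ _ (by linarith) (by positivity) ?_
  intro T hT hs
  have h := card_bound d hd T (r / 4) (R - r / 4) (R + r / 4) (by linarith) (by linarith)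
    (by linarith) (fun x hx => by have : ‖x‖ = R := hT x hx
                                  constructor <;> linarith) (by linarith)
    (fun x hx y hy hxy => by have := hs x hx y hy hxy; linarith)
  obtain ⟨m, rfl⟩ : ∃ m, d = m + 1 := ⟨d - 1, by omega⟩
  set u := 4 * (R / r) with hu
  have hu1 : 1 ≤ R / r := by rw [le_div_iff₀ hr]; linarith
  have e1 : R + r / 4 = (r / 4) * (u + 1) := by rw [hu]; field_simp
  have e2 : R - r / 4 = (r / 4) * (u - 1) := by rw [hu]; field_simp
  rw [e1, e2, mul_pow, mul_pow, ← mul_sub, mul_comm] at h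
  have h' := le_of_mul_le_mul_left h (by positivity)
  refine h'.trans ((pow_diff_le m u (by linarith)).trans ?_)
  simp only [Nat.add_sub_cancel]
  push_cast
  gcongr
  linarith

lemma ball_cover (d : ℕ) (hd : 2 ≤ d) (R r : ℝ) (hr : 0 < r) (hR : 0 ≤ R) :
    ∃ T : Finset (EuclideanSpace ℝ (Fin d)), (T.card : ℝ) ≤ (4 * (R / r) + 2) ^ d + 1 ∧
      {x | ‖x‖ ≤ R} ⊆ ⋃ t ∈ T, closedBall t (r / 2) := by
  classical
  -- cover the part outside the small ball and add the origin
  obtain ⟨T, hT, hTc⟩ := exists_cover_of_card {x : EuclideanSpace ℝ (Fin d) | r / 4 ≤ ‖x‖ ∧ ‖x‖ ≤ R}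
    (r / 2) ((4 * (R / r) + 2) ^ d) (by linarith) (by positivity) (by
    intro T hT hs
    have h := card_bound d hd T (r / 4) 0 (R + r / 4) (by linarith) le_rfl
      (by linarith) (fun x hx => by have := hT x hx
                                    exact ⟨by linarith [this.1], by linarith [this.2]⟩)
      (by linarith)
      (fun x hx y hy hxy => by have := hs x hx y hy hxy; linarith)
    have e1 : R + r / 4 = (r / 4) * (4 * (R / r) + 1) := by field_simp
    rw [zero_pow (by omega), sub_zero, e1, mul_pow, mul_comm] at h
    have h' := le_of_mul_le_mul_left h (by positivity)
    refine h'.trans ?_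
    gcongr
    norm_num)
  refine ⟨insert 0 T, ?_, ?_⟩
  · have := Finset.card_insert_le (0 : EuclideanSpace ℝ (Fin d)) T
    have h2 : ((insert 0 T).card : ℝ) ≤ T.card + 1 := by exact_mod_cast this
    linarith
  · intro x hx
    by_cases h : r / 4 ≤ ‖x‖
    · have := hTc ⟨h, hx⟩
      simp only [mem_iUnion] at this ⊢
      obtain ⟨t, ht, h2⟩ := this
      exact ⟨t, Finset.mem_insert_of_mem ht, h2⟩
    · simp only [mem_iUnion]
      refine ⟨0, Finset.mem_insert_self _ _, ?_⟩
      rw [mem_closedBall, dist_zero_right]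
      linarith

lemma cov_mono {X : Type*} [PseudoMetricSpace X] {θ δ s c c' : ℝ} {E E' : Set X}
    (h : Cov θ δ s E c) (hE : E' ⊆ E) (hc : c ≤ c') : Cov θ δ s E' c' := by
  obtain ⟨𝒰, h1, h2, h3, h4⟩ := h
  exact ⟨𝒰, h1, hE.trans h2, h3, h4.trans (ENNReal.ofReal_le_ofReal hc)⟩

lemma cov_of_two (d : ℕ) (hd : 2 ≤ d) (θ δ s : ℝ) (hδ : 0 < δ) (hδθ : δ ≤ δ ^ θ)
    (E : Set (EuclideanSpace ℝ (Fin d))) (T1 T2 : Finset (EuclideanSpace ℝ (Fin d)))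
    (hE : ∀ x ∈ E, (∃ t ∈ T1, x ∈ closedBall t (δ / 2)) ∨ ∃ t ∈ T2, x ∈ closedBall t (δ ^ θ / 2)) :
    Cov θ δ s E (T1.card * δ ^ s + T2.card * (δ ^ θ) ^ s) := by
  classical
  have : Nonempty (Fin d) := ⟨⟨0, by omega⟩⟩
  have hδ' : 0 < δ ^ θ := by linarith
  have hdiam : ∀ (x : EuclideanSpace ℝ (Fin d)) (r : ℝ), 0 < r → diam (closedBall x (r / 2)) = r := by
    intro x r hr
    rw [diam_closedBall_eq x (by linarith)]; ring
  set 𝒲1 := T1.image (fun t => closedBall t (δ / 2)) with h𝒲1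
  set 𝒲2 := T2.image (fun t => closedBall t (δ ^ θ / 2)) with h𝒲2
  have hd1 : ∀ U ∈ 𝒲1, diam U = δ := by
    intro U hU
    obtain ⟨t, ht, rfl⟩ := Finset.mem_image.1 hU
    exact hdiam _ _ hδ
  have hd2 : ∀ U ∈ 𝒲2, diam U = δ ^ θ := by
    intro U hU
    obtain ⟨t, ht, rfl⟩ := Finset.mem_image.1 hU
    exact hdiam _ _ hδ'
  refine ⟨((𝒲1 ∪ 𝒲2 : Finset _) : Set _), Finset.countable_toSet _, ?_, ?_, ?_⟩
  · intro x hx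
    rcases hE x hx with ⟨t, ht, hxt⟩ | ⟨t, ht, hxt⟩
    · exact ⟨_, Finset.mem_coe.2 (Finset.mem_union_left _ (Finset.mem_image_of_mem _ ht)), hxt⟩
    · exact ⟨_, Finset.mem_coe.2 (Finset.mem_union_right _ (Finset.mem_image_of_mem _ ht)), hxt⟩
  · intro U hU
    rcases Finset.mem_union.1 (Finset.mem_coe.1 hU) with h | h
    · rw [hd1 U h]; exact ⟨le_rfl, hδθ⟩
    · rw [hd2 U h]; exact ⟨hδθ, le_rfl⟩
  · rw [Finset.tsum_subtype' (𝒲1 ∪ 𝒲2) (fun U => ENNReal.ofReal (diam U ^ s))]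
    have h1 : ∑ U ∈ 𝒲1, ENNReal.ofReal (diam U ^ s) ≤ ENNReal.ofReal (T1.card * δ ^ s) := by
      rw [Finset.sum_congr rfl (fun U hU => by rw [hd1 U hU]), Finset.sum_const, nsmul_eq_mul,
        ENNReal.ofReal_mul (by positivity), ENNReal.ofReal_natCast]
      gcongr
      exact Finset.card_image_le
    have h2 : ∑ U ∈ 𝒲2, ENNReal.ofReal (diam U ^ s) ≤ ENNReal.ofReal (T2.card * (δ ^ θ) ^ s) := by
      rw [Finset.sum_congr rfl (fun U hU => by rw [hd2 U hU]), Finset.sum_const, nsmul_eq_mul,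
        ENNReal.ofReal_mul (by positivity), ENNReal.ofReal_natCast]
      gcongr
      exact Finset.card_image_le
    have h3 := Finset.sum_union_inter (s₁ := 𝒲1) (s₂ := 𝒲2)
      (f := fun U => ENNReal.ofReal (diam U ^ s))
    calc _ ≤ ∑ U ∈ 𝒲1, ENNReal.ofReal (diam U ^ s) + ∑ U ∈ 𝒲2, ENNReal.ofReal (diam U ^ s) := by
          rw [← h3]; exact le_self_add
      _ ≤ _ := by
          rw [ENNReal.ofReal_add (by positivity) (by positivity)]
          exact add_le_add h1 h2

lemma le_rpow_theta {θ δ : ℝ} (hδ : 0 < δ) (hδ1 : δ < 1) (hθ' : θ ≤ 1) : δ ≤ δ ^ θ := by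
  calc δ = δ ^ (1 : ℝ) := (Real.rpow_one δ).symm
    _ ≤ δ ^ θ := Real.rpow_le_rpow_of_exponent_ge hδ hδ1.le hθ'

lemma cov_concentric (d : ℕ) (hd : 2 ≤ d) (p : ℝ) (hp : 0 < p) (θ δ s : ℝ) (hθ' : θ ≤ 1)
    (hδ : 0 < δ) (hδ1 : δ < 1) (N : ℕ) (hN : 1 ≤ N) (hNδ : δ ≤ (N : ℝ) ^ (-p)) :
    Cov θ δ s (concentric d p)
      ((∑ n ∈ Finset.Icc 1 N, 2 * d * (5 * ((n : ℝ) ^ (-p) / δ)) ^ (d - 1)) * δ ^ s +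
        ((4 * ((N : ℝ) ^ (-p) / δ ^ θ) + 2) ^ d + 1) * (δ ^ θ) ^ s) := by
  classical
  have hδθ := le_rpow_theta hδ hδ1 hθ'
  have hδ' : 0 < δ ^ θ := by linarith
  have hmono : ∀ n m : ℕ, 1 ≤ n → n ≤ m → (m : ℝ) ^ (-p) ≤ (n : ℝ) ^ (-p) := by
    intro n m hn hnm
    exact Real.rpow_le_rpow_of_nonpos (by exact_mod_cast hn) (by exact_mod_cast hnm) (by linarith)
  have hS : ∀ n : ℕ, ∃ T : Finset (EuclideanSpace ℝ (Fin d)), n ∈ Finset.Icc 1 N →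
      (T.card : ℝ) ≤ 2 * d * (5 * ((n : ℝ) ^ (-p) / δ)) ^ (d - 1) ∧
      {x | ‖x‖ = (n : ℝ) ^ (-p)} ⊆ ⋃ t ∈ T, closedBall t (δ / 2) := by
    intro n
    by_cases hn : n ∈ Finset.Icc 1 N
    · obtain ⟨T, hT⟩ := sphere_cover d hd ((n : ℝ) ^ (-p)) δ hδ
        (hNδ.trans (hmono n N (Finset.mem_Icc.1 hn).1 (Finset.mem_Icc.1 hn).2))
      exact ⟨T, fun _ => hT⟩
    · exact ⟨∅, fun h => absurd h hn⟩
  choose T hT using hS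
  obtain ⟨T2, hT2, hT2c⟩ := ball_cover d hd ((N : ℝ) ^ (-p)) (δ ^ θ) hδ' (by positivity)
  refine cov_mono (cov_of_two d hd θ δ s hδ hδθ (concentric d p) ((Finset.Icc 1 N).biUnion T) T2 ?_)
    Subset.rfl ?_
  · rintro x ⟨n, hn, hx⟩
    by_cases hnN : n ≤ N
    · left
      have := (hT n (Finset.mem_Icc.2 ⟨hn, hnN⟩)).2 hx
      simp only [mem_iUnion] at this
      obtain ⟨t, ht, h⟩ := this
      exact ⟨t, Finset.mem_biUnion.2 ⟨n, Finset.mem_Icc.2 ⟨hn, hnN⟩, ht⟩, h⟩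
    · right
      have hx2 : ‖x‖ ≤ (N : ℝ) ^ (-p) := by
        rw [hx]; exact hmono N n hN (by omega)
      have := hT2c hx2
      simp only [mem_iUnion] at this
      obtain ⟨t, ht, h⟩ := this
      exact ⟨t, ht, h⟩
  · have h1 : (((Finset.Icc 1 N).biUnion T).card : ℝ) ≤
        ∑ n ∈ Finset.Icc 1 N, 2 * d * (5 * ((n : ℝ) ^ (-p) / δ)) ^ (d - 1) := by
      calc (((Finset.Icc 1 N).biUnion T).card : ℝ) ≤ ((∑ n ∈ Finset.Icc 1 N, (T n).card : ℕ) : ℝ) := by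
            exact_mod_cast Finset.card_biUnion_le
        _ = ∑ n ∈ Finset.Icc 1 N, ((T n).card : ℝ) := by push_cast; rfl
        _ ≤ _ := Finset.sum_le_sum fun n hn => (hT n hn).1
    gcongr

lemma cov_ball (d : ℕ) (hd : 2 ≤ d) (R : ℝ) (hR : 0 ≤ R) (θ δ s : ℝ) (hθ' : θ ≤ 1)
    (hδ : 0 < δ) (hδ1 : δ < 1) :
    Cov θ δ s {x : EuclideanSpace ℝ (Fin d) | ‖x‖ ≤ R}
        (((4 * (R / δ) + 2) ^ d + 1) * δ ^ s) := by
  obtain ⟨T, hT, hTc⟩ := ball_cover d hd R δ hδ hR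
  refine cov_mono (cov_of_two d hd θ δ s hδ (le_rpow_theta hδ hδ1 hθ') _ T ∅ ?_) Subset.rfl ?_
  · intro x hx
    have := hTc hx
    simp only [mem_iUnion] at this
    obtain ⟨t, ht, h⟩ := this
    exact Or.inl ⟨t, ht, h⟩
  · simp only [Finset.card_empty, Nat.cast_zero, zero_mul, add_zero]
    gcongr

/-- `K δ ^ e` is eventually small. -/
lemma ev_small (K e ε : ℝ) (he : 0 < e) (hε : 0 < ε) :
    ∀ᶠ δ : ℝ in nhdsWithin 0 (Ioi 0), K * δ ^ e < ε := by
  have h : Tendsto (fun δ : ℝ => K * δ ^ e) (nhds 0) (nhds (K * 0 ^ e)) :=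
    (Real.continuousAt_rpow_const 0 e (Or.inr he.le)).tendsto.const_mul K
  rw [Real.zero_rpow he.ne', mul_zero] at h
  exact (h.mono_left nhdsWithin_le_nhds).eventually (gt_mem_nhds hε)

lemma ev_exists {P : ℝ → Prop} (h : ∀ᶠ δ : ℝ in nhdsWithin 0 (Ioi 0), P δ) :
    ∃ δ₀ : ℝ, 0 < δ₀ ∧ ∀ δ, 0 < δ → δ < δ₀ → P δ := by
  obtain ⟨u, hu, h2⟩ := (mem_nhdsGT_iff_exists_Ioo_subset).1 h
  exact ⟨u, hu, fun δ h3 h4 => h2 ⟨h3, h4⟩⟩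

lemma adm_ball (d : ℕ) (hd : 2 ≤ d) (R : ℝ) (hR : 0 ≤ R) (θ s : ℝ) (hθ' : θ ≤ 1) (hs : (d : ℝ) < s)
    (E : Set (EuclideanSpace ℝ (Fin d))) (hE : ∀ x ∈ E, ‖x‖ ≤ R) : Adm θ s E := by
  intro ε hε δ₀ hδ₀
  obtain ⟨δ₁, hδ₁, h⟩ := ev_exists (ev_small ((4 * R + 2) ^ d + 1) (s - d) ε (by linarith) hε)
  obtain ⟨δ, hδ, hδlt⟩ := exists_between (lt_min (lt_min hδ₀ hδ₁) one_pos)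
  simp only [lt_min_iff] at hδlt
  refine ⟨δ, hδ, hδlt.1.1, cov_mono (cov_ball d hd R hR θ δ s hθ' hδ hδlt.2) hE ?_⟩
  refine le_trans ?_ (h δ hδ hδlt.1.2).le
  have e1 : δ ^ s = δ ^ d * δ ^ (s - d) := by
    rw [← Real.rpow_natCast, ← Real.rpow_add hδ]; congr 1; ring
  rw [e1, ← mul_assoc]
  gcongr
  rw [add_mul, ← mul_pow, one_mul]
  have h2 : (4 * (R / δ) + 2) * δ = 4 * R + 2 * δ := by field_simp
  rw [h2]
  gcongr
  · linarith [hδlt.2]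
  · exact pow_le_one₀ hδ.le hδlt.2.le

lemma sphere_lower (m : ℕ) (R : ℝ) (hR : 0 < R)
    (𝒰 : Set (Set (EuclideanSpace ℝ (Fin (m + 1))))) (hc : 𝒰.Countable)
    (hcov : {x : EuclideanSpace ℝ (Fin (m + 1)) | ‖x‖ = R} ⊆ ⋃₀ 𝒰) (hpos : ∀ U ∈ 𝒰, 0 < diam U) :
    open Classical in
    ENNReal.ofReal ((R / (m + 1)) ^ m) ≤
      ∑' U : 𝒰, (if ((U : Set _) ∩ {x : EuclideanSpace ℝ (Fin (m + 1)) | ‖x‖ = R}).Nonempty then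
        ENNReal.ofReal (diam (U : Set (EuclideanSpace ℝ (Fin (m + 1)))) ^ m) else 0) := by
  classical
  set S := {x : EuclideanSpace ℝ (Fin (m + 1)) | ‖x‖ = R} with hS
  let π : EuclideanSpace ℝ (Fin (m + 1)) → (Fin m → ℝ) := fun x i => x i.succ
  have hπ : LipschitzWith 1 π := by
    refine LipschitzWith.of_dist_le_mul fun x y => ?_
    rw [NNReal.coe_one, one_mul, dist_pi_le_iff dist_nonneg]
    intro i
    have := PiLp.norm_apply_le (x - y) i.succ
    rw [dist_eq_norm, dist_eq_norm]
    exact this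
  set Q : Set (Fin m → ℝ) := Set.Icc (fun _ => 0) (fun _ => R / (m + 1)) with hQ
  have hvol : MeasureTheory.volume Q = ENNReal.ofReal ((R / (m + 1)) ^ m) := by
    rw [hQ, Real.volume_Icc_pi]
    simp only [sub_zero, Finset.prod_const, Finset.card_univ, Fintype.card_fin]
    rw [ENNReal.ofReal_pow (by positivity)]
  have hsub : Q ⊆ ⋃ U ∈ 𝒰, π '' (U ∩ S) := by
    intro y hy
    have hy1 : ∀ i, y i ^ 2 ≤ (R / (m + 1)) ^ 2 := fun i => by
      have h0 : 0 ≤ y i := hy.1 i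
      have h1 : y i ≤ R / (m + 1) := hy.2 i
      exact pow_le_pow_left₀ h0 h1 2
    have hsum : ∑ i, y i ^ 2 ≤ R ^ 2 := by
      calc ∑ i, y i ^ 2 ≤ ∑ _i : Fin m, (R / (m + 1)) ^ 2 := Finset.sum_le_sum fun i _ => hy1 i
        _ = m * (R / (m + 1)) ^ 2 := by simp
        _ ≤ (m + 1) ^ 2 * (R / (m + 1)) ^ 2 := by
            gcongr
            have : (0 : ℝ) ≤ m := Nat.cast_nonneg m
            nlinarith
        _ = R ^ 2 := by field_simp
    let x : EuclideanSpace ℝ (Fin (m + 1)) :=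
      WithLp.toLp 2 (Fin.cons (Real.sqrt (R ^ 2 - ∑ i, y i ^ 2)) y)
    have hx : ‖x‖ = R := by
      rw [EuclideanSpace.norm_eq, Fin.sum_univ_succ]
      simp only [x, Fin.cons_zero, Fin.cons_succ, Real.norm_eq_abs, sq_abs]
      rw [Real.sq_sqrt (by linarith), sub_add_cancel, Real.sqrt_sq hR.le]
    obtain ⟨U, hU, hxU⟩ := hcov hx
    simp only [mem_iUnion]
    refine ⟨U, hU, x, ⟨hxU, hx⟩, ?_⟩
    funext i
    simp [π, x]
  rw [← hvol]
  refine (MeasureTheory.measure_mono hsub).trans ((MeasureTheory.measure_biUnion_le _ hc _).trans ?_)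
  refine ENNReal.tsum_le_tsum fun U => ?_
  split_ifs with h
  · have hbd : Bornology.IsBounded (U : Set (EuclideanSpace ℝ (Fin (m + 1)))) := by
      by_contra hb
      have := hpos U U.2
      rw [diam_eq_zero_of_unbounded hb] at this
      exact lt_irrefl _ this
    have h1 := Real.volume_pi_le_diam_pow (π '' ((U : Set _) ∩ S))
    rw [Fintype.card_fin] at h1
    refine h1.trans ?_
    rw [ENNReal.ofReal_pow diam_nonneg]
    gcongr
    have h2 := hπ.ediam_image_le ((U : Set _) ∩ S)
    rw [ENNReal.coe_one, one_mul] at h2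
    refine h2.trans ?_
    rw [diam, ENNReal.ofReal_toReal hbd.ediam_ne_top]
    exact ediam_mono inter_subset_left
  · rw [Set.not_nonempty_iff_eq_empty.1 h]
    simp

lemma rpow_gap (p x y : ℝ) (hp : 0 < p) (hx : 0 < x) (hy : 0 < y) :
    p * y ^ (-p - 1) * (y - x) ≤ x ^ (-p) - y ^ (-p) := by
  have ht : 0 < x / y := by positivity
  have h1 : 1 + p * (1 - x / y) ≤ (x / y) ^ (-p) := by
    rw [Real.rpow_def_of_pos ht]
    have := Real.add_one_le_exp (Real.log (x / y) * -p)
    have h2 := Real.log_le_sub_one_of_pos ht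
    nlinarith
  rw [Real.div_rpow hx.le hy.le, le_div_iff₀ (by positivity)] at h1
  have e : y ^ (-p - 1) = y ^ (-p) / y := by rw [Real.rpow_sub_one hy.ne']
  rw [e]
  have : p * (y ^ (-p) / y) * (y - x) = p * (1 - x / y) * y ^ (-p) := by field_simp
  rw [this]
  nlinarith

lemma hits_card {X : Type*} [SeminormedAddCommGroup X] (p : ℝ) (hp : 0 < p) (N : ℕ) (H : Finset ℕ)
    (ρ : ℕ → ℝ) (U : Set X) (hU : 0 < diam U)
    (hH : ∀ k ∈ H, 1 ≤ k ∧ k ≤ N ∧ ((k : ℝ) + 1) ^ (-p) < ρ k ∧ ρ k ≤ (k : ℝ) ^ (-p))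
    (hit : ∀ k ∈ H, ∃ x ∈ U, ‖x‖ = ρ k) :
    (H.card : ℝ) ≤ 2 + diam U * ((2 * N) ^ (p + 1) / p) := by
  rcases H.eq_empty_or_nonempty with rfl | hne
  · simp only [Finset.card_empty, Nat.cast_zero]; positivity
  have hbd : Bornology.IsBounded U := by
    by_contra hb
    rw [diam_eq_zero_of_unbounded hb] at hU
    exact lt_irrefl _ hU
  set k := H.min' hne with hk
  set l := H.max' hne with hl
  have hkH : k ∈ H := H.min'_mem hne
  have hlH : l ∈ H := H.max'_mem hne
  have hkl : k ≤ l := H.min'_le _ hlH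
  have hcard : H.card ≤ l - k + 1 := by
    have : H ⊆ Finset.Icc k l := fun x hx => Finset.mem_Icc.2 ⟨H.min'_le _ hx, H.le_max' _ hx⟩
    have := Finset.card_le_card this
    rw [Nat.card_Icc] at this
    omega
  have hcard' : (H.card : ℝ) ≤ (l : ℝ) - k + 1 := by
    have : (H.card : ℝ) ≤ ((l - k + 1 : ℕ) : ℝ) := by exact_mod_cast hcard
    rw [Nat.cast_add, Nat.cast_sub hkl] at this
    simpa using this
  obtain ⟨hk1, hkN, hk3, hk4⟩ := hH k hkH
  obtain ⟨hl1, hlN, hl3, hl4⟩ := hH l hlH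
  have hl1' : (1 : ℝ) ≤ l := by exact_mod_cast hl1
  have hlN' : (l : ℝ) ≤ N := by exact_mod_cast hlN
  obtain ⟨x, hx, hxk⟩ := hit k hkH
  obtain ⟨y, hy, hyl⟩ := hit l hlH
  have hdiff : ρ k - ρ l ≤ diam U := by
    calc ρ k - ρ l = ‖x‖ - ‖y‖ := by rw [hxk, hyl]
      _ ≤ ‖x - y‖ := norm_sub_norm_le x y
      _ = dist x y := (dist_eq_norm x y).symm
      _ ≤ diam U := dist_le_diam_of_mem hbd hx hy
  have hgap := rpow_gap p ((k : ℝ) + 1) l hp (by positivity) (by linarith)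
  by_cases hlk : (l : ℝ) - k - 1 ≤ 0
  · have : 0 ≤ diam U * ((2 * (N : ℝ)) ^ (p + 1) / p) := by positivity
    linarith
  push Not at hlk
  have hN : (0 : ℝ) < N := by linarith
  have hmon : (2 * (N : ℝ)) ^ (-p - 1) ≤ (l : ℝ) ^ (-p - 1) :=
    Real.rpow_le_rpow_of_nonpos (by linarith) (by linarith) (by linarith)
  have h5 : p * (2 * (N : ℝ)) ^ (-p - 1) * ((l : ℝ) - k - 1) ≤ diam U := by
    calc p * (2 * (N : ℝ)) ^ (-p - 1) * ((l : ℝ) - k - 1)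
        ≤ p * (l : ℝ) ^ (-p - 1) * ((l : ℝ) - k - 1) := by gcongr
      _ = p * (l : ℝ) ^ (-p - 1) * ((l : ℝ) - (k + 1)) := by ring
      _ ≤ diam U := by linarith
  have e : (2 * (N : ℝ)) ^ (-p - 1) = ((2 * (N : ℝ)) ^ (p + 1))⁻¹ := by
    rw [← Real.rpow_neg (by positivity)]; congr 1; ring
  rw [e] at h5
  have hA : 0 < (2 * (N : ℝ)) ^ (p + 1) := by positivity
  have h6 : (l : ℝ) - k - 1 ≤ diam U * ((2 * (N : ℝ)) ^ (p + 1) / p) := by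
    rw [mul_div_assoc', le_div_iff₀ hp]
    have : p * ((2 * (N : ℝ)) ^ (p + 1))⁻¹ * ((l : ℝ) - k - 1)
      = (p * ((l : ℝ) - k - 1)) / (2 * (N : ℝ)) ^ (p + 1) := by field_simp
    rw [this, div_le_iff₀ hA] at h5
    linarith
  linarith

lemma lower_main (m : ℕ) (p : ℝ) (hp : 0 < p) (a : ℕ → ℝ) (θ δ s ε : ℝ)
    (hδ : 0 < δ) (hms : (m : ℝ) ≤ s) (hsd : s ≤ m + 1) (hε : 0 ≤ ε)
    (hcov : Cov θ δ s (concentricSeq (m + 1) a) ε) (N : ℕ) (hN : 1 ≤ N) (G : Finset ℕ)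
    (hG : ∀ k ∈ G, 1 ≤ k ∧ k ≤ N ∧ ∃ i, a i ∈ Set.Ioc (((k : ℝ) + 1) ^ (-p)) ((k : ℝ) ^ (-p))) :
    G.card * ((2 * N : ℝ) ^ (-p) / (m + 1)) ^ m ≤
      ε * (2 * δ ^ (m - s) + δ ^ (θ * (m + 1 - s)) * ((2 * N) ^ (p + 1) / p)) := by
  classical
  obtain ⟨𝒰, hc, hsub, hdiam, htsum⟩ := hcov
  have hpos : ∀ U ∈ 𝒰, 0 < diam U := fun U hU => lt_of_lt_of_le hδ (hdiam U hU).1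
  have hidx : ∀ k : ℕ, ∃ i, k ∈ G → a i ∈ Set.Ioc (((k : ℝ) + 1) ^ (-p)) ((k : ℝ) ^ (-p)) := by
    intro k
    by_cases hk : k ∈ G
    · obtain ⟨i, hi⟩ := (hG k hk).2.2
      exact ⟨i, fun _ => hi⟩
    · exact ⟨0, fun h => absurd h hk⟩
  choose i hi using hidx
  set B := 2 * δ ^ (m - s) + δ ^ (θ * (m + 1 - s)) * ((2 * (N : ℝ)) ^ (p + 1) / p) with hB
  have hB0 : 0 ≤ B := by positivity
  have hN1 : (1 : ℝ) ≤ N := by exact_mod_cast hN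
  -- lower bound for each radius
  have hlow : ∀ k ∈ G, ENNReal.ofReal (((2 * N : ℝ) ^ (-p) / (m + 1)) ^ m) ≤
      ∑' U : 𝒰, (if ((U : Set _) ∩ {x : EuclideanSpace ℝ (Fin (m + 1)) | ‖x‖ = a (i k)}).Nonempty
        then ENNReal.ofReal (diam (U : Set (EuclideanSpace ℝ (Fin (m + 1)))) ^ m) else 0) := by
    intro k hk
    have hk' := hi k hk
    have hk0 : (0 : ℝ) < (k : ℝ) + 1 := by positivity
    have hR : 0 < a (i k) := lt_trans (Real.rpow_pos_of_pos hk0 _) hk'.1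
    refine le_trans ?_ (sphere_lower m (a (i k)) hR 𝒰 hc
      (fun x hx => hsub ⟨i k, hx⟩) hpos)
    apply ENNReal.ofReal_le_ofReal
    gcongr
    refine le_trans ?_ hk'.1.le
    refine Real.rpow_le_rpow_of_nonpos hk0 ?_ (by linarith)
    have : (k : ℝ) ≤ N := by exact_mod_cast (hG k hk).2.1
    linarith
  have hU : ∀ U : 𝒰, ∑ k ∈ G, (if ((U : Set _) ∩
        {x : EuclideanSpace ℝ (Fin (m + 1)) | ‖x‖ = a (i k)}).Nonempty
        then ENNReal.ofReal (diam (U : Set (EuclideanSpace ℝ (Fin (m + 1)))) ^ m) else 0)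
      ≤ ENNReal.ofReal B *
        ENNReal.ofReal (diam (U : Set (EuclideanSpace ℝ (Fin (m + 1)))) ^ s) := by
    rintro ⟨U, hU⟩
    simp only
    rw [← Finset.sum_filter, Finset.sum_const, nsmul_eq_mul, ← ENNReal.ofReal_natCast,
      ← ENNReal.ofReal_mul (by positivity), ← ENNReal.ofReal_mul hB0]
    apply ENNReal.ofReal_le_ofReal
    have hu := hpos U hU
    obtain ⟨hu1, hu2⟩ := hdiam U hU
    have hcard := hits_card p hp N (G.filter (fun k => (U ∩
        {x : EuclideanSpace ℝ (Fin (m + 1)) | ‖x‖ = a (i k)}).Nonempty)) (fun k => a (i k)) U hu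
      (fun k hk => by
        have hk' := (Finset.mem_filter.1 hk).1
        exact ⟨(hG k hk').1, (hG k hk').2.1, (hi k hk').1, (hi k hk').2⟩)
      (fun k hk => (Finset.mem_filter.1 hk).2)
    set u := diam U
    have e1 : u ^ m = u ^ (m - s) * u ^ s := by
      rw [← Real.rpow_add hu, ← Real.rpow_natCast]; congr 1; ring
    have e2 : u * u ^ (m - s) = u ^ (m + 1 - s) := by
      rw [show (m : ℝ) + 1 - s = 1 + (m - s) by ring, Real.rpow_add hu, Real.rpow_one]
    have h1 : u ^ (m - s) ≤ δ ^ (m - s) := Real.rpow_le_rpow_of_nonpos hδ hu1 (by linarith)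
    have h2 : u ^ (m + 1 - s) ≤ δ ^ (θ * (m + 1 - s)) := by
      rw [Real.rpow_mul hδ.le]
      exact Real.rpow_le_rpow hu.le hu2 (by linarith)
    rw [e1, ← mul_assoc]
    gcongr
    calc _ ≤ (2 + u * ((2 * (N : ℝ)) ^ (p + 1) / p)) * u ^ (m - s) := by gcongr
      _ = 2 * u ^ (m - s) + (u * u ^ (m - s)) * ((2 * (N : ℝ)) ^ (p + 1) / p) := by ring
      _ ≤ B := by rw [e2, hB]; gcongr
  have key : ENNReal.ofReal (G.card * ((2 * N : ℝ) ^ (-p) / (m + 1)) ^ m) ≤ ENNReal.ofReal (ε * B) := by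
    calc ENNReal.ofReal (G.card * ((2 * N : ℝ) ^ (-p) / (m + 1)) ^ m)
        = ∑ k ∈ G, ENNReal.ofReal (((2 * N : ℝ) ^ (-p) / (m + 1)) ^ m) := by
          rw [Finset.sum_const, nsmul_eq_mul, ENNReal.ofReal_mul (by positivity),
            ENNReal.ofReal_natCast]
      _ ≤ ∑ k ∈ G, ∑' U : 𝒰, (if ((U : Set _) ∩
            {x : EuclideanSpace ℝ (Fin (m + 1)) | ‖x‖ = a (i k)}).Nonempty
          then ENNReal.ofReal (diam (U : Set (EuclideanSpace ℝ (Fin (m + 1)))) ^ m) else 0) :=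
          Finset.sum_le_sum hlow
      _ = ∑' U : 𝒰, ∑ k ∈ G, (if ((U : Set _) ∩
            {x : EuclideanSpace ℝ (Fin (m + 1)) | ‖x‖ = a (i k)}).Nonempty
          then ENNReal.ofReal (diam (U : Set (EuclideanSpace ℝ (Fin (m + 1)))) ^ m) else 0) :=
          (Summable.tsum_finsetSum fun _ _ => ENNReal.summable).symm
      _ ≤ ∑' U : 𝒰, ENNReal.ofReal B *
          ENNReal.ofReal (diam (U : Set (EuclideanSpace ℝ (Fin (m + 1)))) ^ s) :=
          ENNReal.tsum_le_tsum hU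
      _ = ENNReal.ofReal B * ∑' U : 𝒰,
          ENNReal.ofReal (diam (U : Set (EuclideanSpace ℝ (Fin (m + 1)))) ^ s) := ENNReal.tsum_mul_left
      _ ≤ ENNReal.ofReal B * ENNReal.ofReal ε := by gcongr
      _ = ENNReal.ofReal (ε * B) := by rw [← ENNReal.ofReal_mul hB0, mul_comm]
  exact (ENNReal.ofReal_le_ofReal_iff (by positivity)).1 key

lemma adm_gt (m : ℕ) (a : ℕ → ℝ) (hapos : ∀ n, 0 < a n) (θ s : ℝ) (hθ : 0 < θ)
    (h : Adm θ s (concentricSeq (m + 1) a)) : (m : ℝ) < s := by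
  classical
  by_contra! hs
  have hc0 : 0 < (a 0 / (m + 1)) ^ m := by have := hapos 0; positivity
  obtain ⟨δ, hδ, hδ1, 𝒰, hc, hsub, hdiam, htsum⟩ := h ((a 0 / (m + 1)) ^ m / 2) (by linarith) 1 one_pos
  have hpos : ∀ U ∈ 𝒰, 0 < diam U := fun U hU => lt_of_lt_of_le hδ (hdiam U hU).1
  have h1 := sphere_lower m (a 0) (hapos 0) 𝒰 hc (fun x hx => hsub ⟨0, hx⟩) hpos
  have h2 : ENNReal.ofReal ((a 0 / (m + 1)) ^ m) ≤ ENNReal.ofReal ((a 0 / (m + 1)) ^ m / 2) := by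
    refine h1.trans (le_trans (ENNReal.tsum_le_tsum fun U => ?_) htsum)
    split_ifs
    · apply ENNReal.ofReal_le_ofReal
      rw [← Real.rpow_natCast]
      refine Real.rpow_le_rpow_of_exponent_ge (hpos U U.2) ?_ hs
      exact (hdiam U U.2).2.trans (Real.rpow_le_one hδ.le hδ1.le hθ.le)
    · exact zero_le
  rw [ENNReal.ofReal_le_ofReal_iff (by linarith)] at h2
  linarith

lemma sum_rpow_le (q : ℝ) (hq0 : 0 ≤ q) (hq1 : q < 1) (N : ℕ) :
    ∑ n ∈ Finset.Icc 1 N, (n : ℝ) ^ (-q) ≤ (N : ℝ) ^ (1 - q) / (1 - q) := by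
  have he : 0 < 1 - q := by linarith
  induction N with
  | zero => simp [Real.zero_rpow he.ne']
  | succ N ih =>
    rw [Finset.sum_Icc_succ_top (by omega)]
    have hy : (0 : ℝ) < (N : ℝ) + 1 := by positivity
    have hb := rpow_one_add_le_one_add_mul_self (s := -(1 / ((N : ℝ) + 1))) (p := 1 - q)
      (by rw [neg_le_neg_iff, div_le_one hy]; linarith [(Nat.cast_nonneg N : (0 : ℝ) ≤ N)])
      he.le (by linarith)
    have e1 : (N : ℝ) ^ (1 - q) = ((N : ℝ) + 1) ^ (1 - q) * (1 + -(1 / ((N : ℝ) + 1))) ^ (1 - q) := by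
      rw [← Real.mul_rpow hy.le]
      · congr 1; field_simp; ring
      · have : 1 / ((N : ℝ) + 1) ≤ 1 := by
          rw [div_le_one hy]; linarith [(Nat.cast_nonneg N : (0 : ℝ) ≤ N)]
        linarith
    have e2 : ((N : ℝ) + 1) ^ (-q) = ((N : ℝ) + 1) ^ (1 - q) * (1 / ((N : ℝ) + 1)) := by
      rw [show -q = (1 - q) - 1 by ring, Real.rpow_sub_one hy.ne']; ring
    rw [le_div_iff₀ he] at ih ⊢
    push_cast
    have hP : 0 ≤ ((N : ℝ) + 1) ^ (1 - q) := by positivity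
    have := mul_le_mul_of_nonneg_left hb hP
    rw [← e1] at this
    rw [add_mul, e2]
    nlinarith

lemma upper_main (m : ℕ) (hm : 1 ≤ m) (p : ℝ) (hp : 0 < p) (q : ℝ) (hq0 : 0 ≤ q) (hq1 : q < 1)
    (hqp : q ≤ p * m) (θ δ s x : ℝ) (hθ' : θ ≤ 1) (hδ : 0 < δ) (hδ1 : δ < 1) (hx : 1 ≤ x)
    (hxδ : x ^ p * δ ≤ 1) :
    Cov θ δ s (concentric (m + 1) p)
      (2 * (m + 1) * 5 ^ m / (1 - q) * (x ^ (1 - q) * δ ^ (s - m)) +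
       8 ^ (m + 1) * 2 ^ (p * (m + 1)) * (x ^ (-(p * (m + 1))) * δ ^ (-(θ * (m + 1 - s)))) +
       (4 ^ (m + 1) + 1) * δ ^ (θ * s)) := by
  have he : 0 < 1 - q := by linarith
  have hx0 : 0 < x := by linarith
  set N := ⌊x⌋₊ with hN
  have hN1 : 1 ≤ N := Nat.le_floor (by simpa using hx)
  have hNx : (N : ℝ) ≤ x := Nat.floor_le hx0.le
  have hN1' : (1 : ℝ) ≤ N := by exact_mod_cast hN1
  have hxN : x / 2 ≤ N := by
    have := Nat.lt_floor_add_one x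
    rw [← hN] at this
    linarith
  have hδN : δ ≤ (N : ℝ) ^ (-p) := by
    rw [Real.rpow_neg (by positivity), le_inv_comm₀ hδ (by positivity)]
    calc (N : ℝ) ^ p ≤ x ^ p := Real.rpow_le_rpow (by positivity) hNx hp.le
      _ ≤ δ⁻¹ := by rw [← one_div, le_div_iff₀ hδ]; exact hxδ
  refine cov_mono (cov_concentric (m + 1) (by omega) p hp θ δ s hθ' hδ hδ1 N hN1 hδN) Subset.rfl ?_
  have hfirst : (∑ n ∈ Finset.Icc 1 N, 2 * ((m + 1 : ℕ) : ℝ) *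
      (5 * ((n : ℝ) ^ (-p) / δ)) ^ (m + 1 - 1)) * δ ^ s ≤
      2 * (m + 1) * 5 ^ m / (1 - q) * (x ^ (1 - q) * δ ^ (s - m)) := by
    have h1 : ∀ n ∈ Finset.Icc 1 N, 2 * ((m + 1 : ℕ) : ℝ) *
        (5 * ((n : ℝ) ^ (-p) / δ)) ^ (m + 1 - 1) ≤ (2 * (m + 1) * 5 ^ m / δ ^ m) * (n : ℝ) ^ (-q) := by
      intro n hn
      have hn1 : (1 : ℝ) ≤ n := by exact_mod_cast (Finset.mem_Icc.1 hn).1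
      have h2 : ((n : ℝ) ^ (-p)) ^ m ≤ (n : ℝ) ^ (-q) := by
        rw [← Real.rpow_natCast, ← Real.rpow_mul (by positivity)]
        exact Real.rpow_le_rpow_of_exponent_le hn1 (by linarith)
      calc 2 * ((m + 1 : ℕ) : ℝ) * (5 * ((n : ℝ) ^ (-p) / δ)) ^ (m + 1 - 1)
          = (2 * (m + 1) * 5 ^ m / δ ^ m) * ((n : ℝ) ^ (-p)) ^ m := by
            rw [Nat.add_sub_cancel, mul_pow, div_pow]; push_cast; ring
        _ ≤ _ := by gcongr
    have e1 : δ ^ s = δ ^ m * δ ^ (s - m) := by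
      rw [← Real.rpow_natCast, ← Real.rpow_add hδ]; congr 1; ring
    calc _ ≤ (∑ n ∈ Finset.Icc 1 N, (2 * (m + 1) * 5 ^ m / δ ^ m) * (n : ℝ) ^ (-q)) * δ ^ s := by
          exact mul_le_mul_of_nonneg_right (Finset.sum_le_sum h1) (by positivity)
      _ = (2 * (m + 1) * 5 ^ m / δ ^ m) * (∑ n ∈ Finset.Icc 1 N, (n : ℝ) ^ (-q)) * δ ^ s := by
          rw [Finset.mul_sum]
      _ ≤ (2 * (m + 1) * 5 ^ m / δ ^ m) * (x ^ (1 - q) / (1 - q)) * δ ^ s := by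
          gcongr
          refine (sum_rpow_le q hq0 hq1 N).trans ?_
          gcongr
      _ = _ := by rw [e1]; field_simp
  have hsecond : ((4 * ((N : ℝ) ^ (-p) / δ ^ θ) + 2) ^ (m + 1) + 1) * (δ ^ θ) ^ s ≤
      8 ^ (m + 1) * 2 ^ (p * (m + 1)) * (x ^ (-(p * (m + 1))) * δ ^ (-(θ * (m + 1 - s)))) +
       (4 ^ (m + 1) + 1) * δ ^ (θ * s) := by
    set y := (N : ℝ) ^ (-p) / δ ^ θ with hy
    have hy0 : 0 ≤ y := by positivity
    have h1 : (4 * y + 2) ^ (m + 1) ≤ 8 ^ (m + 1) * y ^ (m + 1) + 4 ^ (m + 1) := by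
      have h2 := add_pow_le (by positivity : 0 ≤ 4 * y) (by norm_num : (0 : ℝ) ≤ 2) (m + 1)
      refine h2.trans ?_
      rw [Nat.add_sub_cancel]
      calc (2 : ℝ) ^ m * ((4 * y) ^ (m + 1) + 2 ^ (m + 1))
          ≤ 2 ^ (m + 1) * ((4 * y) ^ (m + 1) + 2 ^ (m + 1)) := by
            gcongr
            · norm_num
            · omega
        _ = _ := by rw [mul_add, ← mul_pow, ← mul_pow, ← mul_pow]; ring_nf
    have h3 : y ^ (m + 1) * (δ ^ θ) ^ s ≤
        2 ^ (p * (m + 1)) * (x ^ (-(p * (m + 1))) * δ ^ (-(θ * (m + 1 - s)))) := by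
      have h4 : (N : ℝ) ^ (-p) ≤ 2 ^ p * x ^ (-p) := by
        calc (N : ℝ) ^ (-p) ≤ (x / 2) ^ (-p) :=
              Real.rpow_le_rpow_of_nonpos (by linarith) hxN (by linarith)
          _ = 2 ^ p * x ^ (-p) := by
              rw [Real.div_rpow hx0.le (by norm_num), Real.rpow_neg (by norm_num : (0 : ℝ) ≤ 2)]
              field_simp
      have h5 : y ^ (m + 1) ≤ (2 ^ p * x ^ (-p) / δ ^ θ) ^ (m + 1) := by rw [hy]; gcongr
      have e2 : (2 ^ p * x ^ (-p) / δ ^ θ) ^ (m + 1) * (δ ^ θ) ^ s =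
          2 ^ (p * (m + 1)) * (x ^ (-(p * (m + 1))) * δ ^ (-(θ * (m + 1 - s)))) := by
        rw [div_pow, mul_pow, ← Real.rpow_natCast, ← Real.rpow_natCast, ← Real.rpow_natCast,
          ← Real.rpow_mul (by norm_num), ← Real.rpow_mul hx0.le, ← Real.rpow_mul hδ.le,
          ← Real.rpow_mul hδ.le, show -(θ * (m + 1 - s)) = θ * s - θ * ((m + 1 : ℕ) : ℝ) by
            push_cast; ring, Real.rpow_sub hδ]
        push_cast
        rw [neg_mul]
        ring
      calc _ ≤ (2 ^ p * x ^ (-p) / δ ^ θ) ^ (m + 1) * (δ ^ θ) ^ s := by gcongr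
        _ = _ := e2
    have e3 : (δ ^ θ) ^ s = δ ^ (θ * s) := (Real.rpow_mul hδ.le _ _).symm
    calc _ ≤ (8 ^ (m + 1) * y ^ (m + 1) + 4 ^ (m + 1) + 1) * (δ ^ θ) ^ s := by gcongr
      _ = 8 ^ (m + 1) * (y ^ (m + 1) * (δ ^ θ) ^ s) + (4 ^ (m + 1) + 1) * (δ ^ θ) ^ s := by ring
      _ ≤ 8 ^ (m + 1) * (2 ^ (p * (m + 1)) * (x ^ (-(p * (m + 1))) * δ ^ (-(θ * (m + 1 - s)))))
          + (4 ^ (m + 1) + 1) * (δ ^ θ) ^ s := by gcongr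
      _ = _ := by rw [e3]; ring
  linarith

lemma lower_cont (m : ℕ) (p : ℝ) (hp : 0 < p) (a : ℕ → ℝ)
    (hinf : 0 < liminf (fun n : ℕ =>
      (Set.ncard {k : ℕ | 1 ≤ k ∧ k ≤ n ∧
        ∃ i : ℕ, a i ∈ Set.Ioc (((k : ℝ) + 1) ^ (-p)) ((k : ℝ) ^ (-p))} : ℝ) / n) atTop) :
    ∃ c C x₀ : ℝ, 0 < c ∧ 0 < C ∧ 1 ≤ x₀ ∧ ∀ x θ δ s ε : ℝ, x₀ ≤ x → 0 < δ → (m : ℝ) ≤ s →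
      s ≤ m + 1 → 0 ≤ ε → Cov θ δ s (concentricSeq (m + 1) a) ε →
      c * x ^ (1 - p * m) ≤ ε * (δ ^ (m - s) + C * x ^ (p + 1) * δ ^ (θ * (m + 1 - s))) := by
  classical
  obtain ⟨c0, hc0, hc1⟩ := exists_between hinf
  have hev := eventually_lt_of_lt_liminf hc1
    (isBoundedUnder_of_eventually_ge (a := 0) (Eventually.of_forall fun n => by positivity))
  obtain ⟨N₀, hN₀⟩ := eventually_atTop.1 hev
  refine ⟨c0 / 4 * (2 ^ (-p) / (m + 1)) ^ m, 2 ^ (p + 1) / p, N₀ + 1, by positivity, by positivity,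
    by linarith [(Nat.cast_nonneg N₀ : (0 : ℝ) ≤ N₀)], ?_⟩
  intro x θ δ s ε hx hδ hms hsm hε hcov
  have hN₀' : (0 : ℝ) ≤ N₀ := Nat.cast_nonneg N₀
  have hx1 : 1 ≤ x := by linarith
  have hx0 : 0 < x := by linarith
  set N := ⌊x⌋₊ with hN
  have hN1 : 1 ≤ N := Nat.le_floor (by simpa using hx1)
  have hNN : N₀ ≤ N := Nat.le_floor (by linarith)
  have hNx : (N : ℝ) ≤ x := Nat.floor_le hx0.le
  have hN1' : (1 : ℝ) ≤ N := by exact_mod_cast hN1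
  have hxN : x / 2 ≤ N := by
    have := Nat.lt_floor_add_one x
    rw [← hN] at this
    linarith
  set G := (Finset.Icc 1 N).filter (fun k : ℕ =>
    ∃ i : ℕ, a i ∈ Set.Ioc (((k : ℝ) + 1) ^ (-p)) ((k : ℝ) ^ (-p))) with hG
  have hGset : {k : ℕ | 1 ≤ k ∧ k ≤ N ∧
        ∃ i : ℕ, a i ∈ Set.Ioc (((k : ℝ) + 1) ^ (-p)) ((k : ℝ) ^ (-p))} = (G : Set ℕ) := by
    ext k
    simp only [hG, mem_ofPred_eq, Finset.coe_filter, Finset.mem_Icc, and_assoc]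
  have h1 := hN₀ N hNN
  rw [hGset, Set.ncard_coe_finset, lt_div_iff₀ (by linarith)] at h1
  have h2 := lower_main m p hp a θ δ s ε hδ hms hsm hε hcov N hN1 G (by
    intro k hk
    obtain ⟨h3, h4⟩ := Finset.mem_filter.1 hk
    exact ⟨(Finset.mem_Icc.1 h3).1, (Finset.mem_Icc.1 h3).2, h4⟩)
  have h5 : (2 : ℝ) ^ (-p) * x ^ (-p) ≤ (2 * (N : ℝ)) ^ (-p) := by
    rw [← Real.mul_rpow (by norm_num) hx0.le]
    exact Real.rpow_le_rpow_of_nonpos (by linarith) (by linarith) (by linarith)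
  have h6 : (2 * (N : ℝ)) ^ (p + 1) ≤ 2 ^ (p + 1) * x ^ (p + 1) := by
    rw [← Real.mul_rpow (by norm_num) hx0.le]
    exact Real.rpow_le_rpow (by positivity) (by linarith) (by linarith)
  have e1 : x ^ (1 - p * m) = x * (x ^ (-p)) ^ m := by
    rw [← Real.rpow_natCast, ← Real.rpow_mul hx0.le, sub_eq_add_neg, Real.rpow_add hx0, Real.rpow_one,
      neg_mul]
  have h7 : 2 * (c0 / 4 * (2 ^ (-p) / (m + 1)) ^ m * x ^ (1 - p * m)) ≤
      G.card * ((2 * N : ℝ) ^ (-p) / (m + 1)) ^ m := by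
    calc 2 * (c0 / 4 * (2 ^ (-p) / (m + 1)) ^ m * x ^ (1 - p * m))
        = (c0 * (x / 2)) * (2 ^ (-p) * x ^ (-p) / (m + 1)) ^ m := by
          rw [e1, div_pow, div_pow, mul_pow]; ring
      _ ≤ G.card * ((2 * N : ℝ) ^ (-p) / (m + 1)) ^ m := by
          gcongr
          refine le_trans ?_ h1.le
          gcongr
  have h8 : ε * (2 * δ ^ (m - s) + δ ^ (θ * (m + 1 - s)) * ((2 * (N : ℝ)) ^ (p + 1) / p)) ≤
      2 * (ε * (δ ^ (m - s) + 2 ^ (p + 1) / p * x ^ (p + 1) * δ ^ (θ * (m + 1 - s)))) := by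
    have : δ ^ (θ * (m + 1 - s)) * ((2 * (N : ℝ)) ^ (p + 1) / p) ≤
        2 * (2 ^ (p + 1) / p * x ^ (p + 1) * δ ^ (θ * (m + 1 - s))) := by
      calc _ ≤ δ ^ (θ * (m + 1 - s)) * (2 ^ (p + 1) * x ^ (p + 1) / p) := by gcongr
        _ = 1 * (2 ^ (p + 1) / p * x ^ (p + 1) * δ ^ (θ * (m + 1 - s))) := by ring
        _ ≤ _ := by gcongr; norm_num
    nlinarith
  linarith

lemma case_one (m : ℕ) (hm : 1 ≤ m) (p : ℝ) (hp : 0 < p) (q : ℝ) (hq0 : 0 ≤ q) (hq1 : q < 1)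
    (hqp : q ≤ p * m) (θ s ε : ℝ) (hθ : 0 < θ) (hθ' : θ ≤ 1) (hms : (m : ℝ) < s) (hsm : s < m + 1)
    (hε : 0 < ε) :
    ∀ᶠ δ : ℝ in nhdsWithin 0 (Ioi 0),
      2 * (m + 1) * 5 ^ m / (1 - q) * ((δ ^ (-(1 / (2 * p)))) ^ (1 - q) * δ ^ (s - m)) ≤ ε / 3 →
      Cov θ δ s (concentric (m + 1) p) ε := by
  have hm1 : (1 : ℝ) ≤ m := by exact_mod_cast hm
  have he2 : 0 < ((m : ℝ) + 1) / 2 - θ * (m + 1 - s) := by nlinarith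
  have h2 := ev_small (8 ^ (m + 1) * 2 ^ (p * (m + 1))) _ (ε / 3) he2 (by linarith)
  have h3 := ev_small (4 ^ (m + 1) + 1) (θ * s) (ε / 3) (by nlinarith) (by linarith)
  have h1 : ∀ᶠ δ : ℝ in nhdsWithin 0 (Ioi 0), δ < 1 :=
    nhdsWithin_le_nhds (gt_mem_nhds one_pos)
  filter_upwards [h1, h2, h3, self_mem_nhdsWithin] with δ h1 h2 h3 hδ hfirst
  have hδ : 0 < δ := hδ
  have hx1 : 1 ≤ δ ^ (-(1 / (2 * p))) :=
    Real.one_le_rpow_of_pos_of_le_one_of_nonpos hδ h1.le (by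
      have : 0 < 1 / (2 * p) := by positivity
      linarith)
  have hxδ : (δ ^ (-(1 / (2 * p)))) ^ p * δ ≤ 1 := by
    rw [← Real.rpow_mul hδ.le]
    nth_rewrite 2 [← Real.rpow_one δ]
    rw [← Real.rpow_add hδ]
    refine Real.rpow_le_one hδ.le h1.le ?_
    have : 1 / (2 * p) * p = 1 / 2 := by field_simp
    linarith
  refine cov_mono (upper_main m hm p hp q hq0 hq1 hqp θ δ s _ hθ' hδ h1 hx1 hxδ) Subset.rfl ?_
  have e : (δ ^ (-(1 / (2 * p)))) ^ (-(p * (m + 1))) * δ ^ (-(θ * (m + 1 - s))) =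
      δ ^ (((m : ℝ) + 1) / 2 - θ * (m + 1 - s)) := by
    rw [← Real.rpow_mul hδ.le, ← Real.rpow_add hδ]
    congr 1
    field_simp
    ring
  rw [e]
  linarith

set_option maxHeartbeats 800000 in
lemma adm_transfer (m : ℕ) (hm : 1 ≤ m) (p : ℝ) (hp : 0 < p) (a : ℕ → ℝ)
    (hinf : 0 < liminf (fun n : ℕ =>
      (Set.ncard {k : ℕ | 1 ≤ k ∧ k ≤ n ∧
        ∃ i : ℕ, a i ∈ Set.Ioc (((k : ℝ) + 1) ^ (-p)) ((k : ℝ) ^ (-p))} : ℝ) / n) atTop)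
    (θ s : ℝ) (hθ : 0 < θ) (hθ' : θ ≤ 1) (hms : (m : ℝ) < s) (hsm : s < m + 1)
    (h : Adm θ s (concentricSeq (m + 1) a)) : Adm θ s (concentric (m + 1) p) := by
  intro ε hε δ₀ hδ₀
  have hm1 : (1 : ℝ) ≤ m := by exact_mod_cast hm
  by_cases hpm : p * m < 1
  · -- the interesting case
    have hpm0 : 0 ≤ p * m := by positivity
    have he : 0 < 1 - p * m := by linarith
    obtain ⟨c, C, x₀, hc, hC, hx₀, hlow⟩ := lower_cont m p hp a hinf
    set K1 : ℝ := 2 * (m + 1) * 5 ^ m / (1 - p * m) with hK1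
    set K2 : ℝ := 8 ^ (m + 1) * 2 ^ (p * (m + 1)) with hK2
    have hK1p : 0 < K1 := by positivity
    have hK2p : 0 < K2 := by positivity
    set ε' : ℝ := min (c * ε / (6 * K1)) (c * ε / (6 * K2 * C)) with hε'
    have hε'p : 0 < ε' := lt_min (by positivity) (by positivity)
    have hε1 : ε' * (6 * K1) ≤ c * ε := by
      rw [← le_div_iff₀ (by positivity)]; exact min_le_left _ _
    have hε2 : ε' * (6 * K2 * C) ≤ c * ε := by
      rw [← le_div_iff₀ (by positivity)]; exact min_le_right _ _
    have h1 : ∀ᶠ δ : ℝ in nhdsWithin 0 (Ioi 0), δ < 1 :=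
      nhdsWithin_le_nhds (gt_mem_nhds one_pos)
    have h3 := ev_small (4 ^ (m + 1) + 1) (θ * s) (ε / 3) (by nlinarith) (by linarith)
    have h4 := ev_small (x₀ ^ (1 - p * m)) (s - m) (ε / (3 * K1)) (by linarith) (by positivity)
    have h5 := case_one m hm p hp (p * m) hpm0 hpm le_rfl θ s ε hθ hθ' hms hsm hε
    obtain ⟨δ₁, hδ₁, hev⟩ := ev_exists (h1.and (h3.and (h4.and h5)))
    obtain ⟨δ, hδ, hδlt, hcov⟩ := h ε' hε'p (min δ₀ δ₁) (lt_min hδ₀ hδ₁)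
    obtain ⟨hlt0, hlt1⟩ := lt_min_iff.1 hδlt
    obtain ⟨h1, h3, h4, h5⟩ := hev δ hδ hlt1
    refine ⟨δ, hδ, hlt0, ?_⟩
    by_cases hcase : K1 * ((δ ^ (-(1 / (2 * p)))) ^ (1 - p * m) * δ ^ (s - m)) ≤ ε / 3
    · exact h5 hcase
    push Not at hcase
    have hD : 0 < δ ^ (s - m) := by positivity
    set x : ℝ := (ε / (3 * K1) / δ ^ (s - m)) ^ (1 / (1 - p * m)) with hx
    have hbase : 0 < ε / (3 * K1) / δ ^ (s - m) := by positivity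
    have hxp : 0 < x := Real.rpow_pos_of_pos hbase _
    have hxe : x ^ (1 - p * m) = ε / (3 * K1) / δ ^ (s - m) := by
      rw [hx, ← Real.rpow_mul hbase.le, one_div_mul_cancel he.ne', Real.rpow_one]
    have hxe' : x ^ (1 - p * m) * δ ^ (s - m) = ε / (3 * K1) := by
      rw [hxe]; field_simp
    have hx₀x : x₀ ≤ x := by
      rw [← Real.rpow_le_rpow_iff (by linarith) hxp.le he, hxe, le_div_iff₀ hD]
      exact h4.le
    have hx1 : 1 ≤ x := by linarith
    have hxX : x ≤ δ ^ (-(1 / (2 * p))) := by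
      rw [← Real.rpow_le_rpow_iff hxp.le (by positivity) he, hxe, div_le_iff₀ hD,
        div_le_iff₀ (by positivity)]
      linarith
    have hxδ : x ^ p * δ ≤ 1 := by
      calc x ^ p * δ ≤ (δ ^ (-(1 / (2 * p)))) ^ p * δ := by gcongr
        _ ≤ 1 := by
          rw [← Real.rpow_mul hδ.le]
          nth_rewrite 2 [← Real.rpow_one δ]
          rw [← Real.rpow_add hδ]
          refine Real.rpow_le_one hδ.le h1.le ?_
          have : 1 / (2 * p) * p = 1 / 2 := by field_simp
          linarith
    refine cov_mono (upper_main m hm p hp (p * m) hpm0 hpm le_rfl θ δ s x hθ' hδ h1 hx1 hxδ)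
      Subset.rfl ?_
    rw [← hK1, ← hK2, hxe']
    have t1 : K1 * (ε / (3 * K1)) = ε / 3 := by field_simp
    have t2 : K2 * (x ^ (-(p * (m + 1))) * δ ^ (-(θ * (m + 1 - s)))) ≤ ε / 3 := by
      have hl := hlow x θ δ s ε' hx₀x hδ hms.le hsm.le hε'p.le hcov
      set A := x ^ (1 - p * m) with hA
      set W := δ ^ (θ * (m + 1 - s)) with hW
      have hWp : 0 < W := by positivity
      have hAp : 0 < A := by positivity
      have eδ : δ ^ (m - s) = A * (3 * K1) / ε := by
        have : δ ^ ((m : ℝ) - s) = (δ ^ (s - m))⁻¹ := by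
          rw [← Real.rpow_neg hδ.le]; congr 1; ring
        rw [this, hxe]; field_simp
      have hfirst : ε' * δ ^ (m - s) ≤ c / 2 * A := by
        rw [eδ, mul_div_assoc', div_le_iff₀ hε]
        have := mul_le_mul_of_nonneg_right hε1 (by linarith : 0 ≤ A / 2)
        linarith
      have hsec : c / 2 * A ≤ ε' * C * x ^ (p + 1) * W := by
        rw [mul_add] at hl
        linarith
      have eA : A = x ^ (-(p * (m + 1))) * x ^ (p + 1) := by
        rw [hA, ← Real.rpow_add hxp]; congr 1; ring
      have hY : 0 < x ^ (p + 1) := by positivity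
      set Z := x ^ (-(p * (m + 1))) with hZ
      have hsec' : c / 2 * Z ≤ ε' * C * W := by
        rw [eA] at hsec
        refine le_of_mul_le_mul_right ?_ hY
        linarith
      rw [Real.rpow_neg hδ.le, ← hW, ← div_eq_mul_inv, mul_div_assoc', div_le_iff₀ hWp]
      have h6 : K2 * (c / 2 * Z) ≤ K2 * (ε' * C * W) := by gcongr
      have h7 : ε' * (6 * K2 * C) * W ≤ c * ε * W := by gcongr
      refine le_of_mul_le_mul_left ?_ hc
      linarith
    linarith
  · push Not at hpm
    set η : ℝ := min 1 (p * (s - m)) with hη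
    have hηp : 0 < η := lt_min one_pos (mul_pos hp (by linarith))
    have hη1 : η ≤ 1 := min_le_left _ _
    have hη2 : η ≤ p * (s - m) := min_le_right _ _
    have h5 := case_one m hm p hp (1 - η) (by linarith) (by linarith) (by linarith) θ s ε hθ hθ'
      hms hsm hε
    have hexp : 0 < -(1 / (2 * p)) * (1 - (1 - η)) + (s - m) := by
      have : 1 / (2 * p) * η ≤ (s - m) / 2 := by
        calc 1 / (2 * p) * η ≤ 1 / (2 * p) * (p * (s - m)) := by gcongr
          _ = (s - m) / 2 := by field_simp
      linarith
    have h6 := ev_small (2 * (m + 1) * 5 ^ m / (1 - (1 - η))) _ (ε / 3) hexp (by linarith)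
    obtain ⟨δ₁, hδ₁, hev⟩ := ev_exists (h5.and h6)
    obtain ⟨δ, hδ, hδlt⟩ := exists_between (lt_min hδ₀ hδ₁)
    obtain ⟨hlt0, hlt1⟩ := lt_min_iff.1 hδlt
    obtain ⟨h5, h6⟩ := hev δ hδ hlt1
    refine ⟨δ, hδ, hlt0, h5 ?_⟩
    rw [← Real.rpow_mul hδ.le, ← Real.rpow_add hδ]
    exact h6.le

theorem stmt6 (d : ℕ) (hd : 2 ≤ d) (p : ℝ) (hp : 0 < p) (a : ℕ → ℝ)
    (ha : StrictAnti a) (hapos : ∀ n, 0 < a n) (halim : Tendsto a atTop (nhds 0))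
    (hinf : 0 < liminf (fun n : ℕ =>
      (Set.ncard {k : ℕ | 1 ≤ k ∧ k ≤ n ∧
        ∃ i : ℕ, a i ∈ Set.Ioc (((k : ℝ) + 1) ^ (-p)) ((k : ℝ) ^ (-p))} : ℝ) / n) atTop)
    (θ : ℝ) (hθ : 0 < θ) (hθ' : θ ≤ 1) :
    lodim θ (concentric d p) ≤ lodim θ (concentricSeq d a) := by
  obtain ⟨m, rfl⟩ : ∃ m, d = m + 1 := ⟨d - 1, by omega⟩
  have hm : 1 ≤ m := by omega
  have hne : {s : ℝ | 0 ≤ s ∧ Adm θ s (concentricSeq (m + 1) a)}.Nonempty := by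
    refine ⟨((m + 1 : ℕ) : ℝ) + 1, by positivity, ?_⟩
    refine adm_ball (m + 1) hd (a 0) (hapos 0).le θ _ hθ' (by linarith) _ ?_
    rintro x ⟨n, hn⟩
    rw [hn]
    exact ha.antitone (Nat.zero_le n)
  rw [lodim_eq θ (concentricSeq (m + 1) a)]
  refine le_csInf hne ?_
  rintro s ⟨hs0, hs⟩
  have hms := adm_gt m a hapos θ s hθ hs
  by_cases hsm : s < m + 1
  · exact lodim_le_of_adm hs0 (adm_transfer m hm p hp a hinf θ s hθ hθ' hms hsm hs)
  · push Not at hsm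
    refine le_of_forall_gt_imp_ge_of_dense fun s' hs' => ?_
    refine lodim_le_of_adm (by linarith) ?_
    refine adm_ball (m + 1) hd 1 zero_le_one θ s' hθ' (by push_cast; linarith) _ ?_
    rintro x ⟨n, hn1, hn⟩
    rw [hn]
    exact Real.rpow_le_one_of_one_le_of_nonpos (by exact_mod_cast hn1) (by linarith)
end

section
/- Let p > 0 and let E ⊆ ℝ² be the set consisting, for each i ∈ ℕ, of 2^i points evenly spread on the circle of radius i^{-p} centred at the origin, namely E := {(i^{-p}·cos(2πk/2^i), i^{-p}·sin(2πk/2^i)) : i ∈ ℕ, k ∈ {0,1,...,2^i - 1}}. Then for every θ ∈ (0,1], lodim_θ(E) ≥ 1/2. In particular, since the Hausdorff dimension of the countable set E is 0, the intermediate dimensions of E are discontinuous at zero. -/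
open Set Metric Filter

/-- For each `i ≥ 1`, `2^i` points evenly spread on the circle of radius `i^{-p}` centred at
the origin. -/
noncomputable def evenPoints (p : ℝ) : Set (EuclideanSpace ℝ (Fin 2)) :=
  {x | ∃ i k : ℕ, 1 ≤ i ∧ k < 2 ^ i ∧
    x 0 = (i : ℝ) ^ (-p) * Real.cos (2 * Real.pi * k / 2 ^ i) ∧
    x 1 = (i : ℝ) ^ (-p) * Real.sin (2 * Real.pi * k / 2 ^ i)}

lemma card_le_of_spread (S : Finset ℕ) (B : ℝ) (hB : 0 ≤ B)
    (h : ∀ k ∈ S, ∀ l ∈ S, (k : ℝ) - l ≤ B) : (S.card : ℝ) ≤ B + 1 := by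
  rcases S.eq_empty_or_nonempty with rfl | hS
  · simp; linarith
  · have h1 : S ⊆ Finset.Icc (S.min' hS) (S.max' hS) := fun k hk =>
      Finset.mem_Icc.2 ⟨S.min'_le k hk, S.le_max' k hk⟩
    have h2 := Finset.card_le_card h1
    rw [Nat.card_Icc] at h2
    have h3 : S.min' hS ≤ S.max' hS := S.min'_le _ (S.max'_mem hS)
    have h4 := h _ (S.max'_mem hS) _ (S.min'_mem hS)
    have h5 : S.card + S.min' hS ≤ S.max' hS + 1 := by omega
    have h6 : (S.card : ℝ) + (S.min' hS : ℕ) ≤ (S.max' hS : ℕ) + 1 := by exact_mod_cast h5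
    linarith

/-- The `k`-th point on the `i`-th circle. -/
noncomputable def circPt (p : ℝ) (i k : ℕ) : EuclideanSpace ℝ (Fin 2) :=
  !₂[(i : ℝ) ^ (-p) * Real.cos (2 * Real.pi * k / 2 ^ i),
    (i : ℝ) ^ (-p) * Real.sin (2 * Real.pi * k / 2 ^ i)]

lemma circPt_dist (p : ℝ) (i k l : ℕ) (hk : 2 * k ≤ 2 ^ i) (hl : 2 * l ≤ 2 ^ i) :
    4 * (i : ℝ) ^ (-p) * ((k : ℝ) - l) / 2 ^ i ≤ dist (circPt p i k) (circPt p i l) := by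
  rw [EuclideanSpace.dist_eq]
  apply Real.le_sqrt_of_sq_le
  simp only [circPt, Fin.sum_univ_two, Real.dist_eq, sq_abs]
  simp only [Matrix.cons_val_zero, Matrix.cons_val_one]
  set r := (i : ℝ) ^ (-p)
  set a := 2 * Real.pi * k / 2 ^ i with ha
  set b := 2 * Real.pi * l / 2 ^ i with hb
  have hpi := Real.pi_pos
  have h2 : (0 : ℝ) < 2 ^ i := by positivity
  have hk' : 2 * (k : ℝ) ≤ 2 ^ i := by exact_mod_cast hk
  have hl' : 2 * (l : ℝ) ≤ 2 ^ i := by exact_mod_cast hl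
  have ha1 : a ≤ Real.pi := by rw [ha, div_le_iff₀ h2]; nlinarith
  have hb1 : b ≤ Real.pi := by rw [hb, div_le_iff₀ h2]; nlinarith
  have ha0 : 0 ≤ a := by positivity
  have hb0 : 0 ≤ b := by positivity
  have hc := Real.cos_le_one_sub_mul_cos_sq (x := a - b) (by rw [abs_le]; constructor <;> linarith)
  rw [Real.cos_sub] at hc
  have e1 := Real.sin_sq_add_cos_sq a
  have e2 := Real.sin_sq_add_cos_sq b
  have e3 : (4 * r * ((k : ℝ) - l) / 2 ^ i) ^ 2 = r ^ 2 * (2 * (2 / Real.pi ^ 2 * (a - b) ^ 2)) := by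
    rw [ha, hb]; field_simp; ring
  rw [e3]
  have : (r * Real.cos a - r * Real.cos b) ^ 2 + (r * Real.sin a - r * Real.sin b) ^ 2
    = r ^ 2 * (2 - 2 * (Real.cos a * Real.cos b + Real.sin a * Real.sin b)) := by
    linear_combination r ^ 2 * e1 + r ^ 2 * e2
  rw [this]
  apply mul_le_mul_of_nonneg_left _ (sq_nonneg r)
  linarith

lemma circPt_mem (p : ℝ) (i k : ℕ) (hi : 1 ≤ i) (hk : k < 2 ^ i) :
    circPt p i k ∈ evenPoints p :=
  ⟨i, k, hi, hk, by simp [circPt], by simp [circPt]⟩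

set_option maxHeartbeats 1000000 in
lemma cover_bound (p : ℝ) (hp : 0 < p) (θ s δ : ℝ) (hs : s < 1)
    (hδ : 0 < δ) (i : ℕ) (hi : 1 ≤ i) (hiδ : 1 ≤ 2 ^ i * δ)
    (𝒰 : Set (Set (EuclideanSpace ℝ (Fin 2)))) (hcov : evenPoints p ⊆ ⋃₀ 𝒰)
    (hU : ∀ U ∈ 𝒰, δ ≤ diam U ∧ diam U ≤ δ ^ θ)
    (hsum : ∑' U : 𝒰, ENNReal.ofReal (diam (U : Set (EuclideanSpace ℝ (Fin 2))) ^ s)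
      ≤ ENNReal.ofReal 1) :
    (i : ℝ) ^ (-p) ≤ 4 * δ ^ (θ * (1 - s)) := by
  classical
  set r := (i : ℝ) ^ (-p) with hr
  have hi0 : (0 : ℝ) < i := by exact_mod_cast hi
  have hr0 : 0 < r := Real.rpow_pos_of_pos hi0 _
  have hr1 : r ≤ 1 := Real.rpow_le_one_of_one_le_of_nonpos (by exact_mod_cast hi) (by linarith)
  have h2 : (0 : ℝ) < 2 ^ i := by positivity
  have hpow : 2 ^ i = 2 * 2 ^ (i - 1) := by
    rw [← pow_succ']; congr 1; omega
  set K := Finset.range (2 ^ (i - 1)) with hK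
  have hKmem : ∀ k ∈ K, 2 * k < 2 ^ i := by
    intro k hk; rw [hK, Finset.mem_range] at hk; omega
  set A : ℝ := 2 * 2 ^ i / r * δ ^ (θ * (1 - s)) with hA
  have hcount : ∀ U ∈ 𝒰, ((K.filter (fun k => circPt p i k ∈ U)).card : ℝ) ≤ A * diam U ^ s := by
    intro U hUm
    obtain ⟨hd1, hd2⟩ := hU U hUm
    have hd0 : 0 < diam U := by linarith
    have hbd : Bornology.IsBounded U := by
      by_contra hnb
      rw [diam_eq_zero_of_unbounded hnb] at hd0
      exact lt_irrefl _ hd0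
    have hc : ((K.filter (fun k => circPt p i k ∈ U)).card : ℝ) ≤ diam U * 2 ^ i / r + 1 := by
      apply card_le_of_spread _ _ (by positivity)
      intro k hk l hl
      rw [Finset.mem_filter] at hk hl
      have h3 := circPt_dist p i k l (hKmem k hk.1).le (hKmem l hl.1).le
      have h4 := dist_le_diam_of_mem hbd hk.2 hl.2
      have h5 := h3.trans h4
      rw [div_le_iff₀ h2] at h5
      rw [le_div_iff₀ hr0]
      have : 0 < diam U * 2 ^ i := by positivity
      linarith
    have h1 : 1 ≤ diam U * 2 ^ i / r := by
      rw [le_div_iff₀ hr0]; nlinarith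
    have hsplit : diam U ≤ diam U ^ s * δ ^ (θ * (1 - s)) := by
      calc diam U = diam U ^ s * diam U ^ (1 - s) := by
            rw [← Real.rpow_add hd0]; simp
        _ ≤ diam U ^ s * (δ ^ θ) ^ (1 - s) := by
            apply mul_le_mul_of_nonneg_left _ (by positivity)
            exact Real.rpow_le_rpow hd0.le hd2 (by linarith)
        _ = _ := by rw [← Real.rpow_mul hδ.le]
    calc _ ≤ diam U * 2 ^ i / r + 1 := hc
      _ ≤ 2 * 2 ^ i / r * diam U := by
          have : 2 * 2 ^ i / r * diam U = diam U * 2 ^ i / r + diam U * 2 ^ i / r := by ring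
          linarith
      _ ≤ 2 * 2 ^ i / r * (diam U ^ s * δ ^ (θ * (1 - s))) :=
          mul_le_mul_of_nonneg_left hsplit (by positivity)
      _ = _ := by rw [hA]; ring
  have hA0 : 0 ≤ A := by positivity
  have key : ((K.card : ℕ) : ENNReal) ≤ ENNReal.ofReal A := by
    calc ((K.card : ℕ) : ENNReal) = ∑ k ∈ K, (1 : ENNReal) := by simp
      _ ≤ ∑ k ∈ K, ∑' U : 𝒰, (if circPt p i k ∈ (U : Set (EuclideanSpace ℝ (Fin 2))) then (1 : ENNReal) else 0) := by
          apply Finset.sum_le_sum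
          intro k hk
          obtain ⟨U, hUm, hkU⟩ := hcov (circPt_mem p i k hi (by have := hKmem k hk; omega))
          refine le_trans ?_ (ENNReal.le_tsum (⟨U, hUm⟩ : 𝒰))
          simp [hkU]
      _ = ∑' U : 𝒰, ∑ k ∈ K, (if circPt p i k ∈ (U : Set (EuclideanSpace ℝ (Fin 2))) then (1 : ENNReal) else 0) :=
          (Summable.tsum_finsetSum (fun _ _ => ENNReal.summable)).symm
      _ ≤ ∑' U : 𝒰, ENNReal.ofReal A * ENNReal.ofReal (diam (U : Set (EuclideanSpace ℝ (Fin 2))) ^ s) := by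
          apply ENNReal.tsum_le_tsum
          intro U
          rw [← ENNReal.ofReal_mul hA0, Finset.sum_boole, ← ENNReal.ofReal_natCast]
          exact ENNReal.ofReal_le_ofReal (hcount U U.2)
      _ = ENNReal.ofReal A * ∑' U : 𝒰, ENNReal.ofReal (diam (U : Set (EuclideanSpace ℝ (Fin 2))) ^ s) :=
          by rw [ENNReal.tsum_mul_left]
      _ ≤ ENNReal.ofReal A * ENNReal.ofReal 1 := mul_le_mul_right hsum _
      _ = ENNReal.ofReal A := by rw [ENNReal.ofReal_one, mul_one]
  rw [← ENNReal.ofReal_natCast, ENNReal.ofReal_le_ofReal_iff hA0] at key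
  simp only [hK, Finset.card_range] at key
  push_cast at key
  have hpow' : (2 : ℝ) ^ i = 2 * 2 ^ (i - 1) := by exact_mod_cast hpow
  rw [hA, hpow', div_mul_eq_mul_div, le_div_iff₀ hr0] at key
  have h3 : (0 : ℝ) < 2 ^ (i - 1) := by positivity
  apply le_of_mul_le_mul_left _ h3
  linarith

lemma threshold (p c : ℝ) (hc : 0 < c) :
    ∃ I : ℕ, 1 ≤ I ∧ ∀ i : ℕ, I ≤ i → 4 * ((2 : ℝ) * (2 ^ i)⁻¹) ^ c < (i : ℝ) ^ (-p) := by
  have h1 : Tendsto (fun x : ℝ => x ^ p * Real.exp (-(c * Real.log 2) * x)) atTop (nhds 0) :=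
    tendsto_rpow_mul_exp_neg_mul_atTop_nhds_zero p _ (mul_pos hc (Real.log_pos one_lt_two))
  have h2 := h1.comp (tendsto_natCast_atTop_atTop (R := ℝ))
  have hpos : (0 : ℝ) < (4 * 2 ^ c)⁻¹ := by positivity
  obtain ⟨I, hI⟩ := eventually_atTop.1 (h2.eventually_lt_const hpos)
  refine ⟨max I 1, le_max_right _ _, fun i hi => ?_⟩
  have h3 := hI i ((le_max_left _ _).trans hi)
  have hi0 : (0 : ℝ) < i := by
    have : 1 ≤ i := (le_max_right _ _).trans hi
    exact_mod_cast this
  simp only [Function.comp] at h3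
  have e : Real.exp (-(c * Real.log 2) * i) = (((2 : ℝ) ^ i)⁻¹) ^ c := by
    rw [Real.rpow_def_of_pos (by positivity), Real.log_inv, Real.log_pow]
    congr 1; ring
  rw [e] at h3
  rw [Real.mul_rpow (by norm_num) (by positivity), Real.rpow_neg hi0.le]
  have hip : (0 : ℝ) < (i : ℝ) ^ p := by positivity
  rw [lt_inv_comm₀ (by positivity) hip]
  rw [← lt_div_iff₀ (by positivity)] at h3
  refine h3.trans_eq ?_
  field_simp

lemma lower_aux (p : ℝ) (hp : 0 < p) (θ : ℝ) (hθ : 0 < θ) (s : ℝ)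
    (h : ∀ ε : ℝ, 0 < ε → ∀ δ₀ : ℝ, 0 < δ₀ → ∃ δ : ℝ, 0 < δ ∧ δ < δ₀ ∧
    ∃ 𝒰 : Set (Set (EuclideanSpace ℝ (Fin 2))), 𝒰.Countable ∧ evenPoints p ⊆ ⋃₀ 𝒰 ∧
      (∀ U ∈ 𝒰, δ ≤ diam U ∧ diam U ≤ δ ^ θ) ∧
      ∑' U : 𝒰, ENNReal.ofReal (diam (U : Set (EuclideanSpace ℝ (Fin 2))) ^ s)
        ≤ ENNReal.ofReal ε) : 1 ≤ s := by
  by_contra! hs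
  have hc : 0 < θ * (1 - s) := mul_pos hθ (by linarith)
  obtain ⟨I, hI1, hI⟩ := threshold p _ hc
  obtain ⟨δ, hδ, hδI, 𝒰, -, hcov, hU, hsum⟩ := h 1 one_pos ((2 ^ I)⁻¹) (by positivity)
  have hex : ∃ i : ℕ, 1 ≤ (2 : ℝ) ^ i * δ := by
    obtain ⟨n, hn⟩ := pow_unbounded_of_one_lt (δ⁻¹) (one_lt_two (α := ℝ))
    refine ⟨n, ?_⟩
    rw [← inv_le_iff_one_le_mul₀ hδ]; exact hn.le
  classical
  let i := Nat.find hex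
  have hi : 1 ≤ (2 : ℝ) ^ i * δ := Nat.find_spec hex
  have hIi : I ≤ i := by
    by_contra! hlt
    have h1 : (2 : ℝ) ^ i ≤ 2 ^ I := pow_le_pow_right₀ one_le_two hlt.le
    have h2 : (2 : ℝ) ^ I * δ < 1 := by
      rw [← lt_inv_mul_iff₀ (by positivity)]; simpa using hδI
    nlinarith
  have hmin : (2 : ℝ) ^ (i - 1) * δ < 1 := by
    have := Nat.find_min hex (m := i - 1) (by change i - 1 < i; omega)
    exact not_le.1 this
  have hpow : (2 : ℝ) ^ i = 2 * 2 ^ (i - 1) := by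
    rw [← pow_succ']; congr 1; omega
  have h1 := cover_bound p hp θ s δ hs hδ i (by omega) hi 𝒰 hcov hU hsum
  have h2 := hI i hIi
  have h3 : δ ≤ 2 * (2 ^ i)⁻¹ := by
    rw [← div_eq_mul_inv, le_div_iff₀ (by positivity), hpow]; linarith
  have h4 := Real.rpow_le_rpow hδ.le h3 hc.le
  linarith

lemma evenPoints_coord (p : ℝ) (hp : 0 < p) (x : EuclideanSpace ℝ (Fin 2))
    (hx : x ∈ evenPoints p) (j : Fin 2) : |x j| ≤ 1 := by
  obtain ⟨i, k, hi, -, h0, h1⟩ := hx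
  have hr1 : (i : ℝ) ^ (-p) ≤ 1 :=
    Real.rpow_le_one_of_one_le_of_nonpos (by exact_mod_cast hi) (by linarith)
  have hr0 : 0 ≤ (i : ℝ) ^ (-p) := by positivity
  fin_cases j
  · simp only [Fin.zero_eta, h0, abs_mul, abs_of_nonneg hr0]
    exact mul_le_one₀ hr1 (abs_nonneg _) (Real.abs_cos_le_one _)
  · simp only [Fin.mk_one, h1, abs_mul, abs_of_nonneg hr0]
    exact mul_le_one₀ hr1 (abs_nonneg _) (Real.abs_sin_le_one _)

lemma upper_aux (p : ℝ) (hp : 0 < p) (θ : ℝ) (hθ1 : θ ≤ 1) :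
    ∀ ε : ℝ, 0 < ε → ∃ δ₀ : ℝ, 0 < δ₀ ∧ ∀ δ : ℝ, 0 < δ → δ < δ₀ →
    ∃ 𝒰 : Set (Set (EuclideanSpace ℝ (Fin 2))), 𝒰.Countable ∧ evenPoints p ⊆ ⋃₀ 𝒰 ∧
      (∀ U ∈ 𝒰, δ ≤ diam U ∧ diam U ≤ δ ^ θ) ∧
      ∑' U : 𝒰, ENNReal.ofReal (diam (U : Set (EuclideanSpace ℝ (Fin 2))) ^ (3 : ℝ))
        ≤ ENNReal.ofReal ε := by
  intro ε hε
  refine ⟨min 1 (ε / 169), by positivity, fun δ hδ hδ0 => ?_⟩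
  have hδ1 : δ < 1 := hδ0.trans_le (min_le_left _ _)
  have hδε : δ < ε / 169 := hδ0.trans_le (min_le_right _ _)
  classical
  let M : ℤ := ⌈4 / δ⌉ + 1
  let T : Finset (ℤ × ℤ) := Finset.Icc (-M) M ×ˢ Finset.Icc (-M) M
  let f : ℤ × ℤ → Set (EuclideanSpace ℝ (Fin 2)) := fun q =>
    closedBall (!₂[(q.1 : ℝ) * (δ / 4), (q.2 : ℝ) * (δ / 4)]) (δ / 2)
  have hM0 : 0 ≤ M := by
    have : 0 ≤ ⌈4 / δ⌉ := Int.ceil_nonneg (by positivity)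
    omega
  have hM : (M : ℝ) ≤ 4 / δ + 2 := by
    have := (Int.ceil_lt_add_one (4 / δ)).le
    simp only [M]; push_cast; linarith
  have hM' : 4 / δ + 1 ≤ (M : ℝ) := by
    have := Int.le_ceil (4 / δ)
    simp only [M]; push_cast; linarith
  have hdiam : ∀ q, diam (f q) = δ := by
    intro q
    simp only [f]
    rw [diam_closedBall_eq _ (by positivity)]; ring
  refine ⟨(T.image f : Finset _), Finset.countable_toSet _, ?_, ?_, ?_⟩
  · intro x hx
    have hfl : ∀ j, -M ≤ ⌊x j / (δ / 4)⌋ ∧ ⌊x j / (δ / 4)⌋ ≤ M := by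
      intro j
      have h1 := abs_le.1 (evenPoints_coord p hp x hx j)
      have e : x j / (δ / 4) = x j * (4 / δ) := by field_simp
      have h4 : 0 < 4 / δ := by positivity
      constructor
      · rw [Int.le_floor, e]; push_cast; nlinarith
      · rw [← Int.cast_le (R := ℝ)]
        refine (Int.floor_le _).trans ?_
        rw [e]; nlinarith
    refine ⟨f (⌊x 0 / (δ / 4)⌋, ⌊x 1 / (δ / 4)⌋), ?_, ?_⟩
    · rw [Finset.mem_coe]
      apply Finset.mem_image_of_mem
      simp only [T, Finset.mem_product, Finset.mem_Icc]
      exact ⟨hfl 0, hfl 1⟩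
    · simp only [f, mem_closedBall]
      rw [EuclideanSpace.dist_eq]
      apply Real.sqrt_le_iff.2 ⟨by positivity, ?_⟩
      simp only [Fin.sum_univ_two, Real.dist_eq, sq_abs]
      simp only [Matrix.cons_val_zero, Matrix.cons_val_one]
      have hj : ∀ j, (x j - ⌊x j / (δ / 4)⌋ * (δ / 4)) ^ 2 ≤ (δ / 4) ^ 2 := by
        intro j
        have h4 : 0 < δ / 4 := by positivity
        have h1 := Int.floor_le (x j / (δ / 4))
        have h2 := (Int.lt_floor_add_one (x j / (δ / 4))).le
        rw [le_div_iff₀ h4] at h1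
        rw [div_le_iff₀ h4] at h2
        apply pow_le_pow_left₀ <;> linarith
      nlinarith [hj 0, hj 1]
  · intro U hU
    rw [Finset.mem_coe, Finset.mem_image] at hU
    obtain ⟨q, -, rfl⟩ := hU
    rw [hdiam]
    refine ⟨le_rfl, ?_⟩
    calc δ = δ ^ (1 : ℝ) := by simp
      _ ≤ δ ^ θ := Real.rpow_le_rpow_of_exponent_ge hδ hδ1.le hθ1
  · rw [Finset.tsum_subtype' (T.image f) (fun U => ENNReal.ofReal (diam U ^ (3 : ℝ)))]
    have h1 : ∀ U ∈ T.image f, ENNReal.ofReal (diam U ^ (3 : ℝ)) = ENNReal.ofReal (δ ^ 3) := by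
      intro U hU
      rw [Finset.mem_image] at hU
      obtain ⟨q, -, rfl⟩ := hU
      rw [hdiam]; norm_cast
    rw [Finset.sum_congr rfl h1, Finset.sum_const, nsmul_eq_mul, ← ENNReal.ofReal_natCast,
      ← ENNReal.ofReal_mul (by positivity)]
    apply ENNReal.ofReal_le_ofReal
    have hcard : ((T.image f).card : ℝ) ≤ (2 * M + 1) ^ 2 := by
      have : (T.image f).card ≤ T.card := Finset.card_image_le
      have h3 : (T.card : ℤ) = (2 * M + 1) ^ 2 := by
        simp only [T, Finset.card_product, Int.card_Icc]
        push_cast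
        rw [Int.toNat_of_nonneg (by omega)]; ring
      have h5 : ((T.image f).card : ℤ) ≤ (2 * M + 1) ^ 2 := by rw [← h3]; exact_mod_cast this
      exact_mod_cast h5
    have hMd : (2 * M + 1) * δ ≤ 13 := by
      have : (M : ℝ) * δ ≤ (4 / δ + 2) * δ := mul_le_mul_of_nonneg_right hM hδ.le
      have e : (4 / δ + 2) * δ = 4 + 2 * δ := by field_simp
      nlinarith
    have hM0' : (0 : ℝ) ≤ M := by exact_mod_cast hM0
    calc ((T.image f).card : ℝ) * δ ^ 3 ≤ (2 * M + 1) ^ 2 * δ ^ 3 := by gcongr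
      _ = ((2 * M + 1) * δ) ^ 2 * δ := by ring
      _ ≤ 13 ^ 2 * δ := by gcongr
      _ ≤ ε := by linarith

lemma updim_ge (p : ℝ) (hp : 0 < p) (θ : ℝ) (hθ : 0 < θ) (hθ1 : θ ≤ 1) :
    1 ≤ updim θ (evenPoints p) := by
  refine le_csInf (Set.nonempty_of_mem (x := (3 : ℝ)) ⟨by norm_num, upper_aux p hp θ hθ1⟩) ?_
  rintro s ⟨-, h⟩
  apply lower_aux p hp θ hθ s
  intro ε hε δ₀ hδ₀
  obtain ⟨d, hd, H⟩ := h ε hε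
  have hm : 0 < min d δ₀ := lt_min hd hδ₀
  exact ⟨min d δ₀ / 2, by positivity, by linarith [min_le_right d δ₀],
    H _ (by positivity) (by linarith [min_le_left d δ₀])⟩

lemma lodim_ge (p : ℝ) (hp : 0 < p) (θ : ℝ) (hθ : 0 < θ) (hθ1 : θ ≤ 1) :
    1 ≤ lodim θ (evenPoints p) := by
  apply le_csInf
  · refine ⟨3, by norm_num, fun ε hε δ₀ hδ₀ => ?_⟩
    obtain ⟨d, hd, H⟩ := upper_aux p hp θ hθ1 ε hε
    have hm : 0 < min d δ₀ := lt_min hd hδ₀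
    exact ⟨min d δ₀ / 2, by positivity, by linarith [min_le_right d δ₀],
      H _ (by positivity) (by linarith [min_le_left d δ₀])⟩
  · rintro s ⟨-, h⟩
    exact lower_aux p hp θ hθ s h

lemma evenPoints_countable (p : ℝ) : (evenPoints p).Countable := by
  apply (countable_range (fun q : ℕ × ℕ => circPt p q.1 q.2)).mono
  rintro x ⟨i, k, -, -, h0, h1⟩
  refine ⟨(i, k), ?_⟩
  ext j
  fin_cases j
  · simp [circPt, h0]
  · simp [circPt, h1]

lemma not_tendsto_aux (g : ℝ → ℝ) (hg : ∀ θ, 0 < θ → θ ≤ 1 → 1 ≤ g θ) :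
    ¬ Tendsto g (nhdsWithin 0 (Set.Ioi 0)) (nhds 0) := by
  intro h
  have h1 : ∀ᶠ θ in nhdsWithin (0 : ℝ) (Set.Ioi 0), 1 ≤ g θ := by
    filter_upwards [Ioc_mem_nhdsGT (zero_lt_one (α := ℝ))] with θ hθ
    exact hg θ hθ.1 hθ.2
  have := ge_of_tendsto h h1
  linarith

theorem stmt15 (p : ℝ) (hp : 0 < p) :
    dimH (evenPoints p) = 0 ∧
    (∀ θ : ℝ, 0 < θ → θ ≤ 1 → 1 / 2 ≤ lodim θ (evenPoints p)) ∧
    ¬ Tendsto (fun θ : ℝ => lodim θ (evenPoints p)) (nhdsWithin 0 (Set.Ioi 0)) (nhds 0) ∧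
    ¬ Tendsto (fun θ : ℝ => updim θ (evenPoints p)) (nhdsWithin 0 (Set.Ioi 0)) (nhds 0) := by
  refine ⟨(evenPoints_countable p).dimH_zero, fun θ hθ hθ1 => ?_, ?_, ?_⟩
  · linarith [lodim_ge p hp θ hθ hθ1]
  · exact not_tendsto_aux _ (fun θ h h1 => lodim_ge p hp θ h h1)
  · exact not_tendsto_aux _ (fun θ h h1 => updim_ge p hp θ h h1)
end

section
/- Let p > 0 and θ ∈ (0,1]. Then the lower and upper θ-intermediate dimensions of the topologist's sine curve T_p both equal (2θ + p)/(θ + p), i.e. lodim_θ(T_p) = updim_θ(T_p) = 1 + θ/(θ + p). -/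
open Set Metric Filter

/-- The topologist's sine curve `T_p = {(t^{-p}, sin(πt)) : t ≥ 1} ⊆ ℝ²`. -/
noncomputable def topSine (p : ℝ) : Set (EuclideanSpace ℝ (Fin 2)) :=
  {x | ∃ t : ℝ, 1 ≤ t ∧ x 0 = t ^ (-p) ∧ x 1 = Real.sin (Real.pi * t)}

lemma ts_sep {p a b M : ℝ} (hp : 0 < p) (ha : 0 < a) (hab : a ≤ b) (hbM : b ≤ M) :
    p * (b - a) * M ^ (-(p + 1)) ≤ a ^ (-p) - b ^ (-p) := by
  have hb : 0 < b := ha.trans_le hab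
  have h1 : M ^ (-(p + 1)) ≤ b ^ (-(p + 1)) :=
    Real.rpow_le_rpow_of_nonpos hb hbM (by linarith)
  have hx : 0 < a / b := by positivity
  have h2 : 1 - p * (a / b - 1) ≤ (a / b) ^ (-p) := by
    rw [Real.rpow_def_of_pos hx]
    have := Real.add_one_le_exp (Real.log (a / b) * -p)
    have h3 := Real.log_le_sub_one_of_pos hx
    nlinarith
  have h4 : a ^ (-p) = b ^ (-p) * (a / b) ^ (-p) := by
    rw [← Real.mul_rpow hb.le hx.le]; congr 1; field_simp
  have h5 : b ^ (-(p + 1)) = b ^ (-p) / b := by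
    rw [neg_add, ← sub_eq_add_neg, Real.rpow_sub_one hb.ne']
  have h6 : 0 < b ^ (-p) := Real.rpow_pos_of_pos hb _
  calc p * (b - a) * M ^ (-(p + 1)) ≤ p * (b - a) * b ^ (-(p + 1)) := by
        apply mul_le_mul_of_nonneg_left h1
        have : 0 ≤ b - a := by linarith
        positivity
    _ = b ^ (-p) * (1 - p * (a / b - 1)) - b ^ (-p) := by rw [h5]; field_simp; ring
    _ ≤ b ^ (-p) * (a / b) ^ (-p) - b ^ (-p) := by gcongr
    _ = _ := by rw [h4]

lemma ts_card {N : ℕ} (F : Finset (Fin N)) (B : ℝ) (hB : 0 ≤ B)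
    (h : ∀ m ∈ F, ∀ n ∈ F, m ≤ n → ((n : ℕ) : ℝ) - ((m : ℕ) : ℝ) ≤ B) : (F.card : ℝ) ≤ 1 + B := by
  rcases F.eq_empty_or_nonempty with rfl | hF
  · simp; linarith
  · have h1 := h _ (F.min'_mem hF) _ (F.max'_mem hF) (F.min'_le _ (F.max'_mem hF))
    have h2 : F ⊆ Finset.Icc (F.min' hF) (F.max' hF) := fun x hx =>
      Finset.mem_Icc.2 ⟨F.min'_le _ hx, F.le_max' _ hx⟩
    have h3 := Finset.card_le_card h2
    rw [Fin.card_Icc] at h3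
    have h4 : ((F.min' hF : Fin N) : ℕ) ≤ ((F.max' hF : Fin N) : ℕ) := F.min'_le _ (F.max'_mem hF)
    have h5 : F.card + ((F.min' hF : Fin N) : ℕ) ≤ ((F.max' hF : Fin N) : ℕ) + 1 := by omega
    have h6 : (F.card : ℝ) + (((F.min' hF : Fin N) : ℕ) : ℝ) ≤ (((F.max' hF : Fin N) : ℕ) : ℝ) + 1 := by
      exact_mod_cast h5
    linarith

/-- A piece of the curve lying over one quarter period. -/
def tsBranch (p : ℝ) (n : ℕ) : Set (EuclideanSpace ℝ (Fin 2)) :=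
  {x | ∃ t : ℝ, 2 * ((n : ℝ) + 1) ≤ t ∧ t ≤ 2 * ((n : ℝ) + 1) + 1 / 2 ∧
    x 0 = t ^ (-p) ∧ x 1 = Real.sin (Real.pi * t)}

lemma ts_abs_le_dist (x y : EuclideanSpace ℝ (Fin 2)) (i : Fin 2) : |x i - y i| ≤ dist x y := by
  rw [EuclideanSpace.dist_eq, ← Real.sqrt_sq_eq_abs]
  apply Real.sqrt_le_sqrt
  have := Finset.single_le_sum (f := fun i => dist (x i) (y i) ^ 2)
    (fun i _ => sq_nonneg _) (Finset.mem_univ i)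
  simpa [Real.dist_eq] using this

lemma ts_cover_one {p : ℝ} (n : ℕ) {𝒰 : Set (Set (EuclideanSpace ℝ (Fin 2)))} (hc : 𝒰.Countable)
    (hE : topSine p ⊆ ⋃₀ 𝒰) :
    1 ≤ ∑' U : 𝒰, MeasureTheory.volume ((fun x : EuclideanSpace ℝ (Fin 2) => x 1) ''
      ((U : Set (EuclideanSpace ℝ (Fin 2))) ∩ tsBranch p n)) := by
  have : Countable 𝒰 := hc.to_subtype
  refine le_trans ?_ (MeasureTheory.measure_iUnion_le _)
  have h1 : (1 : ENNReal) = MeasureTheory.volume (Icc (0 : ℝ) 1) := by simp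
  rw [h1]
  apply MeasureTheory.measure_mono
  intro y hy
  have hcont : ContinuousOn (fun t : ℝ => Real.sin (Real.pi * t))
      (Icc (2 * ((n : ℝ) + 1)) (2 * ((n : ℝ) + 1) + 1 / 2)) := by fun_prop
  have hiv := intermediate_value_Icc (by linarith) hcont
  have e1 : Real.sin (Real.pi * (2 * ((n : ℝ) + 1))) = 0 := by
    have := Real.sin_nat_mul_pi (2 * (n + 1))
    push_cast at this
    rw [mul_comm]; exact this
  have e2 : Real.sin (Real.pi * (2 * ((n : ℝ) + 1) + 1 / 2)) = 1 := by
    have := Real.sin_add_nat_mul_two_pi (Real.pi / 2) (n + 1)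
    rw [Real.sin_pi_div_two] at this
    refine Eq.trans ?_ this
    congr 1; push_cast; ring
  simp only [e1, e2] at hiv
  obtain ⟨t, ht, hty⟩ := hiv hy
  have hn : (0 : ℝ) ≤ n := Nat.cast_nonneg n
  have hmem : (!₂[t ^ (-p), Real.sin (Real.pi * t)] : EuclideanSpace ℝ (Fin 2)) ∈ topSine p :=
    ⟨t, by linarith [ht.1], by simp, by simp⟩
  obtain ⟨U, hU, hxU⟩ := hE hmem
  exact mem_iUnion.2 ⟨⟨U, hU⟩, _, ⟨hxU, t, ht.1, ht.2, by simp, by simp⟩, by simpa using hty⟩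

lemma ts_bdd {X : Type*} [PseudoMetricSpace X] {U : Set X} (h : 0 < diam U) : Bornology.IsBounded U := by
  by_contra hU
  rw [diam_eq_zero_of_unbounded hU] at h
  exact lt_irrefl _ h

lemma ts_vol_le {U V : Set (EuclideanSpace ℝ (Fin 2))} (h : 0 < diam U) (hV : V ⊆ U) :
    MeasureTheory.volume ((fun x : EuclideanSpace ℝ (Fin 2) => x 1) '' V) ≤
      ENNReal.ofReal (diam U) := by
  refine (Real.volume_le_diam _).trans ?_
  apply Metric.ediam_le
  rintro _ ⟨x, hx, rfl⟩ _ ⟨y, hy, rfl⟩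
  rw [edist_dist]
  apply ENNReal.ofReal_le_ofReal
  rw [Real.dist_eq]
  exact (ts_abs_le_dist x y 1).trans (dist_le_diam_of_mem (ts_bdd h) (hV hx) (hV hy))

lemma ts_sum_le {p : ℝ} (hp : 0 < p) {N : ℕ} {U : Set (EuclideanSpace ℝ (Fin 2))} (h : 0 < diam U) :
    ∑' n : Fin N, MeasureTheory.volume ((fun x : EuclideanSpace ℝ (Fin 2) => x 1) ''
      (U ∩ tsBranch p n)) ≤
      ENNReal.ofReal (diam U * (1 + diam U * (3 * N : ℝ) ^ (p + 1) / p)) := by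
  classical
  rw [tsum_fintype]
  set F : Finset (Fin N) := Finset.univ.filter fun n => (U ∩ tsBranch p n).Nonempty with hF
  have h1 : ∀ n : Fin N, MeasureTheory.volume ((fun x : EuclideanSpace ℝ (Fin 2) => x 1) ''
      (U ∩ tsBranch p n)) ≤ if (U ∩ tsBranch p n).Nonempty then ENNReal.ofReal (diam U) else 0 := by
    intro n
    split_ifs with hn
    · exact ts_vol_le h inter_subset_left
    · rw [not_nonempty_iff_eq_empty.1 hn]; simp
  refine (Finset.sum_le_sum fun n _ => h1 n).trans ?_
  rw [← Finset.sum_filter, Finset.sum_const, ← hF, nsmul_eq_mul, ← ENNReal.ofReal_natCast,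
    ← ENNReal.ofReal_mul (Nat.cast_nonneg _), mul_comm]
  apply ENNReal.ofReal_le_ofReal
  apply mul_le_mul_of_nonneg_left _ h.le
  apply ts_card
  · positivity
  intro m hm n hn hmn
  rcases hmn.eq_or_lt with rfl | hlt
  · simp; positivity
  obtain ⟨x, hxU, a, ha1, ha2, hxa, -⟩ := (Finset.mem_filter.1 hm).2
  obtain ⟨y, hyU, b, hb1, hb2, hyb, -⟩ := (Finset.mem_filter.1 hn).2
  have hm0 : (0 : ℝ) ≤ ((m : ℕ) : ℝ) := Nat.cast_nonneg _
  have hmn1 : ((m : ℕ) : ℝ) + 1 ≤ ((n : ℕ) : ℝ) := by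
    have : (m : ℕ) + 1 ≤ (n : ℕ) := hlt
    exact_mod_cast this
  have hnN : ((n : ℕ) : ℝ) + 1 ≤ (N : ℝ) := by
    have : (n : ℕ) + 1 ≤ N := n.2
    exact_mod_cast this
  have hs := ts_sep (M := 3 * N) hp (by linarith : 0 < a) (by linarith : a ≤ b) (by linarith)
  have hd := (ts_abs_le_dist x y 0).trans (dist_le_diam_of_mem (ts_bdd h) hxU hyU)
  rw [hxa, hyb] at hd
  have hd2 := (le_abs_self _).trans hd
  have hM : (0 : ℝ) < 3 * N := by linarith
  have hMp : 0 < (3 * N : ℝ) ^ (p + 1) := Real.rpow_pos_of_pos hM _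
  rw [Real.rpow_neg hM.le] at hs
  have h7 : p * (b - a) ≤ diam U * (3 * N : ℝ) ^ (p + 1) := by
    have := hs.trans hd2
    rwa [← div_eq_mul_inv, div_le_iff₀ hMp] at this
  rw [le_div_iff₀ hp]
  have h8 : ((n : ℕ) : ℝ) - ((m : ℕ) : ℝ) ≤ b - a := by linarith
  nlinarith

lemma ts_lower {p θ δ s : ℝ} (hp : 0 < p) (hθ : 0 < θ) (hδ : 0 < δ) (hδ1 : δ < 1)
    (hs : s ≤ 1 + θ / (θ + p))
    {𝒰 : Set (Set (EuclideanSpace ℝ (Fin 2)))} (hc : 𝒰.Countable)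
    (hE : topSine p ⊆ ⋃₀ 𝒰) (hd : ∀ U ∈ 𝒰, δ ≤ diam U ∧ diam U ≤ δ ^ θ) :
    1 ≤ ENNReal.ofReal (1 + 6 ^ (p + 1) / p) *
      ∑' U : 𝒰, ENNReal.ofReal (diam (U : Set (EuclideanSpace ℝ (Fin 2))) ^ s) := by
  set a := θ / (θ + p) with ha
  have ha0 : 0 < a := by positivity
  have hap : a * (θ + p) = θ := by rw [ha]; field_simp
  set N := ⌈δ ^ (-a)⌉₊ with hN
  have hδa : 1 ≤ δ ^ (-a) := Real.one_le_rpow_of_pos_of_le_one_of_nonpos hδ hδ1.le (by linarith)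
  have hN1 : δ ^ (-a) ≤ N := Nat.le_ceil _
  have hN2 : (N : ℝ) ≤ 2 * δ ^ (-a) := by
    have := (Nat.ceil_lt_add_one (by positivity : 0 ≤ δ ^ (-a))).le
    linarith
  have hC : 0 ≤ 1 + (6 : ℝ) ^ (p + 1) / p := by positivity
  have key : ∀ U ∈ 𝒰, diam U * (1 + diam U * (3 * N : ℝ) ^ (p + 1) / p) ≤
      (δ ^ (-a)) * ((1 + 6 ^ (p + 1) / p) * diam U ^ s) := by
    intro U hU
    obtain ⟨h1, h2⟩ := hd U hU
    set r := diam U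
    have hr : 0 < r := hδ.trans_le h1
    have hr1 : r ≤ 1 := h2.trans (Real.rpow_le_one hδ.le hδ1.le hθ.le)
    have hrs : r ^ (1 + a) ≤ r ^ s := Real.rpow_le_rpow_of_exponent_ge hr hr1 hs
    have hA : r ≤ δ ^ (-a) * r ^ (1 + a) := by
      rw [Real.rpow_add hr, Real.rpow_one, Real.rpow_neg hδ.le]
      have : δ ^ a ≤ r ^ a := Real.rpow_le_rpow hδ.le h1 ha0.le
      have h3 : 0 < δ ^ a := Real.rpow_pos_of_pos hδ _
      rw [inv_mul_eq_div, le_div_iff₀ h3]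
      gcongr
    have hB : (3 * N : ℝ) ^ (p + 1) ≤ 6 ^ (p + 1) * δ ^ (-a * (p + 1)) := by
      rw [Real.rpow_mul hδ.le, ← Real.mul_rpow (by norm_num) (by positivity)]
      apply Real.rpow_le_rpow (by positivity) (by linarith) (by linarith)
    have hD : r * r * δ ^ (-a * (p + 1)) ≤ δ ^ (-a) * r ^ (1 + a) := by
      have h1a : 0 ≤ 1 - a := by nlinarith
      have e1 : r * r = r ^ (1 + a) * r ^ (1 - a) := by
        rw [← Real.rpow_add hr]; norm_num; ring
      have e2 : r ^ (1 - a) ≤ δ ^ (θ * (1 - a)) := by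
        rw [Real.rpow_mul hδ.le]
        exact Real.rpow_le_rpow hr.le h2 h1a
      have e3 : δ ^ (θ * (1 - a)) * δ ^ (-a * (p + 1)) = δ ^ (-a) := by
        rw [← Real.rpow_add hδ]; congr 1; linarith
      rw [e1, ← e3]
      have : 0 < δ ^ (-a * (p + 1)) := Real.rpow_pos_of_pos hδ _
      have : 0 < r ^ (1 + a) := Real.rpow_pos_of_pos hr _
      calc r ^ (1 + a) * r ^ (1 - a) * δ ^ (-a * (p + 1))
          ≤ r ^ (1 + a) * δ ^ (θ * (1 - a)) * δ ^ (-a * (p + 1)) := by gcongr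
        _ = _ := by ring
    calc r * (1 + r * (3 * N : ℝ) ^ (p + 1) / p)
        ≤ r * (1 + r * (6 ^ (p + 1) * δ ^ (-a * (p + 1))) / p) := by gcongr
      _ = r + 6 ^ (p + 1) / p * (r * r * δ ^ (-a * (p + 1))) := by ring
      _ ≤ δ ^ (-a) * r ^ (1 + a) + 6 ^ (p + 1) / p * (δ ^ (-a) * r ^ (1 + a)) := by gcongr
      _ = δ ^ (-a) * ((1 + 6 ^ (p + 1) / p) * r ^ (1 + a)) := by ring
      _ ≤ _ := by gcongr
  have hNN : ENNReal.ofReal (δ ^ (-a)) ≤ ENNReal.ofReal (δ ^ (-a)) *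
      (ENNReal.ofReal (1 + 6 ^ (p + 1) / p) *
      ∑' U : 𝒰, ENNReal.ofReal (diam (U : Set (EuclideanSpace ℝ (Fin 2))) ^ s)) := by
    calc ENNReal.ofReal (δ ^ (-a)) ≤ ENNReal.ofReal N := ENNReal.ofReal_le_ofReal hN1
      _ = ∑' n : Fin N, 1 := by simp
      _ ≤ ∑' n : Fin N, ∑' U : 𝒰, MeasureTheory.volume ((fun x : EuclideanSpace ℝ (Fin 2) => x 1) ''
          ((U : Set (EuclideanSpace ℝ (Fin 2))) ∩ tsBranch p n)) :=
        ENNReal.tsum_le_tsum fun n => ts_cover_one n hc hE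
      _ = ∑' U : 𝒰, ∑' n : Fin N, MeasureTheory.volume ((fun x : EuclideanSpace ℝ (Fin 2) => x 1) ''
          ((U : Set (EuclideanSpace ℝ (Fin 2))) ∩ tsBranch p n)) := ENNReal.tsum_comm
      _ ≤ ∑' U : 𝒰, ENNReal.ofReal (δ ^ (-a)) * (ENNReal.ofReal (1 + 6 ^ (p + 1) / p) *
          ENNReal.ofReal (diam (U : Set (EuclideanSpace ℝ (Fin 2))) ^ s)) := by
        apply ENNReal.tsum_le_tsum
        rintro ⟨U, hU⟩
        refine (ts_sum_le hp (hδ.trans_le (hd U hU).1)).trans ?_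
        rw [← ENNReal.ofReal_mul hC, ← ENNReal.ofReal_mul (by positivity)]
        exact ENNReal.ofReal_le_ofReal (key U hU)
      _ = _ := by rw [ENNReal.tsum_mul_left, ENNReal.tsum_mul_left]
  have hpos : ENNReal.ofReal (δ ^ (-a)) ≠ 0 := by
    rw [Ne, ENNReal.ofReal_eq_zero]; linarith
  nth_rewrite 1 [← mul_one (ENNReal.ofReal (δ ^ (-a)))] at hNN
  exact (ENNReal.mul_le_mul_iff_right hpos ENNReal.ofReal_ne_top).1 hNN

lemma ts_dist_le (x y : EuclideanSpace ℝ (Fin 2)) : dist x y ≤ |x 0 - y 0| + |x 1 - y 1| := by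
  rw [EuclideanSpace.dist_eq, Fin.sum_univ_two, Real.dist_eq, Real.dist_eq]
  apply Real.sqrt_le_iff.2 ⟨by positivity, ?_⟩
  nlinarith [mul_nonneg (abs_nonneg (x 0 - y 0)) (abs_nonneg (x 1 - y 1))]

lemma ts_rpow_lip {p u t : ℝ} (hp : 0 < p) (hu : 1 ≤ u) (hut : u ≤ t) :
    |t ^ (-p) - u ^ (-p)| ≤ p * (t - u) := by
  have hu0 : 0 < u := by linarith
  have ht0 : 0 < t := by linarith
  have h0 : t ^ (-p) ≤ u ^ (-p) := Real.rpow_le_rpow_of_nonpos hu0 hut (by linarith)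
  rw [abs_of_nonpos (by linarith)]
  have hx : 0 < t / u := by positivity
  have h2 : 1 - p * (t / u - 1) ≤ (t / u) ^ (-p) := by
    rw [Real.rpow_def_of_pos hx]
    have := Real.add_one_le_exp (Real.log (t / u) * -p)
    have h3 := Real.log_le_sub_one_of_pos hx
    nlinarith
  have h4 : t ^ (-p) = u ^ (-p) * (t / u) ^ (-p) := by
    rw [← Real.mul_rpow hu0.le hx.le]; congr 1; field_simp
  have h6 : 0 < u ^ (-p) := Real.rpow_pos_of_pos hu0 _
  have h7 : u ^ (-p) ≤ 1 := Real.rpow_le_one_of_one_le_of_nonpos hu (by linarith)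
  have h8 : t / u - 1 ≤ t - u := by
    rw [div_sub_one hu0.ne', div_le_iff₀ hu0]; nlinarith
  have h9 : 0 ≤ t / u - 1 := by
    rw [div_sub_one hu0.ne']; apply div_nonneg <;> linarith
  calc -(t ^ (-p) - u ^ (-p)) = u ^ (-p) - u ^ (-p) * (t / u) ^ (-p) := by rw [h4]; ring
    _ ≤ u ^ (-p) - u ^ (-p) * (1 - p * (t / u - 1)) := by gcongr
    _ = u ^ (-p) * (p * (t / u - 1)) := by ring
    _ ≤ 1 * (p * (t / u - 1)) := by gcongr
    _ ≤ _ := by rw [one_mul]; gcongr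

lemma ts_finset_sum {F : Finset (Set (EuclideanSpace ℝ (Fin 2)))} {r s K : ℝ} (hr : 0 ≤ r)
    (hF : ∀ U ∈ F, diam U = r) (hK : (F.card : ℝ) ≤ K) :
    ∑' U : (F : Set (Set (EuclideanSpace ℝ (Fin 2)))),
      ENNReal.ofReal (diam (U : Set (EuclideanSpace ℝ (Fin 2))) ^ s) ≤
      ENNReal.ofReal (K * r ^ s) := by
  have h1 := Finset.tsum_subtype' F
    (fun U : Set (EuclideanSpace ℝ (Fin 2)) => ENNReal.ofReal (diam U ^ s))
  rw [h1, Finset.sum_congr rfl (fun U hU => by rw [hF U hU]), Finset.sum_const, nsmul_eq_mul,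
    ← ENNReal.ofReal_natCast, ← ENNReal.ofReal_mul (Nat.cast_nonneg _)]
  apply ENNReal.ofReal_le_ofReal
  gcongr

/-- The nearest lower grid point. -/
lemma ts_grid {z A η : ℝ} (hη : 0 < η) (hz : 0 ≤ z) (hzA : z ≤ A) :
    ∃ k ∈ Finset.range (⌊A / η⌋₊ + 1), (k : ℝ) * η ≤ z ∧ z ≤ k * η + η := by
  refine ⟨⌊z / η⌋₊, ?_, ?_, ?_⟩
  · rw [Finset.mem_range, Nat.lt_succ_iff]
    apply Nat.floor_le_floor; gcongr
  · rw [← le_div_iff₀ hη]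
    exact Nat.floor_le (by positivity)
  · have := (Nat.lt_floor_add_one (z / η)).le
    rw [div_le_iff₀ hη] at this
    linarith

lemma ts_upper {p θ δ s : ℝ} (hp : 0 < p) (hθ : 0 < θ) (hθ' : θ ≤ 1) (hδ : 0 < δ) (hδ1 : δ < 1)
    (hs : 1 + θ / (θ + p) ≤ s) :
    ∃ 𝒰 : Set (Set (EuclideanSpace ℝ (Fin 2))), 𝒰.Countable ∧ topSine p ⊆ ⋃₀ 𝒰 ∧
      (∀ U ∈ 𝒰, δ ≤ diam U ∧ diam U ≤ δ ^ θ) ∧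
      ∑' U : 𝒰, ENNReal.ofReal (diam (U : Set (EuclideanSpace ℝ (Fin 2))) ^ s) ≤
        ENNReal.ofReal ((2 * (p + Real.pi) + 97) * δ ^ (θ * (s - (1 + θ / (θ + p))))) := by
  classical
  set a := θ / (θ + p) with ha
  have ha0 : 0 < a := by positivity
  have hap : a * (θ + p) = θ := by rw [ha]; field_simp
  set L := p + Real.pi with hL
  have hL0 : 0 < L := by positivity
  set M := δ ^ (-a) with hM
  have hM1 : 1 ≤ M := Real.one_le_rpow_of_pos_of_le_one_of_nonpos hδ hδ1.le (by linarith)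
  set R := δ ^ θ with hR
  have hR0 : 0 < R := Real.rpow_pos_of_pos hδ _
  have hR1 : R ≤ 1 := Real.rpow_le_one hδ.le hδ1.le hθ.le
  have hδR : δ ≤ R := by
    have := Real.rpow_le_rpow_of_exponent_ge hδ hδ1.le hθ'
    rwa [Real.rpow_one] at this
  set h := δ / (2 * L) with hh
  have hh0 : 0 < h := by positivity
  have hhL : L * h = δ / 2 := by rw [hh]; field_simp
  set η := R / 4 with hη
  have hη0 : 0 < η := by positivity
  set W := M ^ (-p) with hW
  have hW0 : 0 < W := Real.rpow_pos_of_pos (by linarith) _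
  have hWR : R ≤ W := by
    rw [hW, hM, ← Real.rpow_mul hδ.le]
    apply Real.rpow_le_rpow_of_exponent_ge hδ hδ1.le
    nlinarith
  let f : ℕ → Set (EuclideanSpace ℝ (Fin 2)) := fun k =>
    closedBall !₂[(1 + k * h) ^ (-p), Real.sin (Real.pi * (1 + k * h))] (δ / 2)
  let g : ℕ × ℕ → Set (EuclideanSpace ℝ (Fin 2)) := fun k =>
    closedBall !₂[k.1 * η, -1 + k.2 * η] (R / 2)
  set F := (Finset.range (⌊M / h⌋₊ + 1)).image f with hF
  set G := (Finset.range (⌊W / η⌋₊ + 1) ×ˢ Finset.range (⌊2 / η⌋₊ + 1)).image g with hG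
  have hFd : ∀ U ∈ F, diam U = δ := by
    intro U hU
    obtain ⟨k, -, rfl⟩ := Finset.mem_image.1 hU
    simp only [f]
    rw [Metric.diam_closedBall_eq _ (by positivity)]; ring
  have hGd : ∀ U ∈ G, diam U = R := by
    intro U hU
    obtain ⟨k, -, rfl⟩ := Finset.mem_image.1 hU
    simp only [g]
    rw [Metric.diam_closedBall_eq _ (by positivity)]; ring
  have hFc : (F.card : ℝ) ≤ (2 * L + 1) * (M / δ) := by
    have h1 : (F.card : ℝ) ≤ (⌊M / h⌋₊ : ℝ) + 1 := by
      have := Finset.card_image_le (s := Finset.range (⌊M / h⌋₊ + 1)) (f := f)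
      rw [Finset.card_range] at this
      exact_mod_cast this
    have h2 : (⌊M / h⌋₊ : ℝ) ≤ M / h := Nat.floor_le (by positivity)
    have h3 : M / h = 2 * L * (M / δ) := by rw [hh]; field_simp
    have h4 : 1 ≤ M / δ := by rw [le_div_iff₀ hδ]; linarith
    linarith
  have hGc : (G.card : ℝ) ≤ 96 * (W / (R * R)) := by
    have h1 : (G.card : ℝ) ≤ ((⌊W / η⌋₊ : ℝ) + 1) * ((⌊2 / η⌋₊ : ℝ) + 1) := by
      have := Finset.card_image_le
        (s := Finset.range (⌊W / η⌋₊ + 1) ×ˢ Finset.range (⌊2 / η⌋₊ + 1)) (f := g)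
      rw [Finset.card_product, Finset.card_range, Finset.card_range] at this
      exact_mod_cast this
    have h2 : (⌊W / η⌋₊ : ℝ) ≤ W / η := Nat.floor_le (by positivity)
    have h3 : (⌊2 / η⌋₊ : ℝ) ≤ 2 / η := Nat.floor_le (by positivity)
    have h4 : 1 ≤ W / R := by rw [le_div_iff₀ hR0]; linarith
    have h5 : 1 ≤ 1 / R := by rw [le_div_iff₀ hR0]; linarith
    have h6 : W / η = 4 * (W / R) := by rw [hη]; field_simp
    have h7 : 2 / η = 8 * (1 / R) := by rw [hη]; field_simp; norm_num
    calc (G.card : ℝ) ≤ _ := h1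
      _ ≤ (8 * (W / R)) * (12 * (1 / R)) := by gcongr <;> linarith
      _ = _ := by field_simp; norm_num
  have hpow : 0 < δ ^ (θ * (s - (1 + a))) := Real.rpow_pos_of_pos hδ _
  refine ⟨(F : Set _) ∪ (G : Set _), ?_, ?_, ?_, ?_⟩
  · exact (F.countable_toSet).union G.countable_toSet
  · rintro x ⟨t, ht, hx0, hx1⟩
    rcases le_total t M with htM | htM
    · obtain ⟨k, hk, hk1, hk2⟩ := ts_grid (z := t - 1) (A := M) hh0 (by linarith) (by linarith)
      refine mem_sUnion.2 ⟨f k, Or.inl (Finset.mem_coe.2 (Finset.mem_image_of_mem _ hk)), ?_⟩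
      simp only [f, mem_closedBall]
      refine (ts_dist_le _ _).trans ?_
      simp only [hx0, hx1, PiLp.toLp_apply, Matrix.cons_val_zero, Matrix.cons_val_one]
      have hkh : 0 ≤ (k : ℝ) * h := by positivity
      have e1 := ts_rpow_lip (u := 1 + k * h) (t := t) hp (by linarith) (by linarith)
      have e2 : |Real.sin (Real.pi * t) - Real.sin (Real.pi * (1 + k * h))| ≤
          Real.pi * (t - (1 + k * h)) := by
        have := Real.abs_sin_sub_sin_le (Real.pi * t) (Real.pi * (1 + k * h))
        rw [← mul_sub, abs_of_nonneg (mul_nonneg Real.pi_pos.le (by linarith))] at this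
        exact this
      have e3 : (p + Real.pi) * (t - (1 + k * h)) ≤ L * h := by
        rw [hL]; gcongr; linarith
      linarith
    · have hx0' : x 0 ≤ W := by
        rw [hx0]; exact Real.rpow_le_rpow_of_nonpos (by linarith) htM (by linarith)
      have hx0'' : 0 ≤ x 0 := by rw [hx0]; exact Real.rpow_nonneg (by linarith) _
      have hl := Real.neg_one_le_sin (Real.pi * t)
      have hu := Real.sin_le_one (Real.pi * t)
      rw [← hx1] at hl hu
      obtain ⟨k, hk, hk1, hk2⟩ := ts_grid hη0 hx0'' hx0'
      obtain ⟨j, hj, hj1, hj2⟩ := ts_grid (z := x 1 + 1) (A := 2) hη0 (by linarith) (by linarith)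
      refine mem_sUnion.2 ⟨g (k, j), Or.inr (Finset.mem_coe.2 (Finset.mem_image_of_mem _
        (Finset.mk_mem_product hk hj))), ?_⟩
      simp only [g, mem_closedBall]
      refine (ts_dist_le _ _).trans ?_
      simp only [PiLp.toLp_apply, Matrix.cons_val_zero, Matrix.cons_val_one]
      rw [abs_of_nonneg (by linarith), abs_of_nonneg (by linarith)]
      linarith
  · rintro U (hU | hU)
    · rw [hFd U hU]; exact ⟨le_rfl, hδR⟩
    · rw [hGd U hU]; exact ⟨hδR, le_rfl⟩
  · refine (ENNReal.tsum_union_le (fun U : Set (EuclideanSpace ℝ (Fin 2)) =>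
      ENNReal.ofReal (diam U ^ s)) _ _).trans ?_
    refine (add_le_add (ts_finset_sum hδ.le hFd hFc) (ts_finset_sum hR0.le hGd hGc)).trans ?_
    rw [← ENNReal.ofReal_add (by positivity) (by positivity)]
    apply ENNReal.ofReal_le_ofReal
    have e1 : M / δ * δ ^ s ≤ δ ^ (θ * (s - (1 + a))) := by
      have : M / δ * δ ^ s = δ ^ (s - (1 + a)) := by
        rw [hM, ← Real.rpow_sub_one hδ.ne', ← Real.rpow_add hδ]; congr 1; ring
      rw [this]
      apply Real.rpow_le_rpow_of_exponent_ge hδ hδ1.le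
      nlinarith
    have e2 : W / (R * R) * R ^ s = δ ^ (θ * (s - (1 + a))) := by
      rw [hW, hM, hR, ← Real.rpow_mul hδ.le, ← Real.rpow_mul hδ.le, ← Real.rpow_add hδ,
        ← Real.rpow_sub hδ, ← Real.rpow_add hδ]
      congr 1; linarith
    calc (2 * L + 1) * (M / δ) * δ ^ s + 96 * (W / (R * R)) * R ^ s
        = (2 * L + 1) * (M / δ * δ ^ s) + 96 * (W / (R * R) * R ^ s) := by ring
      _ ≤ (2 * L + 1) * δ ^ (θ * (s - (1 + a))) + 96 * δ ^ (θ * (s - (1 + a))) := by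
        rw [e2]; gcongr
      _ = _ := by ring

lemma ts_small {C x ε : ℝ} (hC : 0 < C) (hx : 0 < x) (hε : 0 < ε) :
    ∃ δ₀ : ℝ, 0 < δ₀ ∧ δ₀ ≤ 1 ∧ ∀ δ : ℝ, 0 < δ → δ < δ₀ → C * δ ^ x ≤ ε := by
  refine ⟨min 1 ((ε / C) ^ x⁻¹), lt_min one_pos (Real.rpow_pos_of_pos (by positivity) _),
    min_le_left _ _, fun δ hδ h => ?_⟩
  have h1 : δ ^ x ≤ ((ε / C) ^ x⁻¹) ^ x :=
    Real.rpow_le_rpow hδ.le (h.le.trans (min_le_right _ _)) hx.le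
  rw [Real.rpow_inv_rpow (by positivity) hx.ne', le_div_iff₀ hC] at h1
  linarith

theorem stmt16 (p θ : ℝ) (hp : 0 < p) (hθ : 0 < θ) (hθ' : θ ≤ 1) :
    lodim θ (topSine p) = 1 + θ / (θ + p) ∧ updim θ (topSine p) = 1 + θ / (θ + p) := by
  have ha0 : 0 < θ / (θ + p) := by positivity
  have hpi := Real.pi_pos
  -- every exponent above the critical one is admissible
  have hup : ∀ s : ℝ, 1 + θ / (θ + p) < s → ∀ ε : ℝ, 0 < ε → ∃ δ₀ : ℝ, 0 < δ₀ ∧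
      ∀ δ : ℝ, 0 < δ → δ < δ₀ →
      ∃ 𝒰 : Set (Set (EuclideanSpace ℝ (Fin 2))), 𝒰.Countable ∧ topSine p ⊆ ⋃₀ 𝒰 ∧
      (∀ U ∈ 𝒰, δ ≤ diam U ∧ diam U ≤ δ ^ θ) ∧
      ∑' U : 𝒰, ENNReal.ofReal (diam (U : Set (EuclideanSpace ℝ (Fin 2))) ^ s) ≤
        ENNReal.ofReal ε := by
    intro s hs ε hε
    obtain ⟨δ₀, h0, h1, h2⟩ := ts_small (C := 2 * (p + Real.pi) + 97)
      (x := θ * (s - (1 + θ / (θ + p)))) (by positivity)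
      (mul_pos hθ (by linarith)) hε
    refine ⟨δ₀, h0, fun δ hδ hlt => ?_⟩
    obtain ⟨𝒰, a1, a2, a3, a4⟩ := ts_upper hp hθ hθ' hδ (hlt.trans_le h1) hs.le
    exact ⟨𝒰, a1, a2, a3, a4.trans (ENNReal.ofReal_le_ofReal (h2 δ hδ hlt))⟩
  -- no exponent up to the critical one is admissible
  have hlow : ∀ s : ℝ, (∀ ε : ℝ, 0 < ε → ∀ δ₀ : ℝ, 0 < δ₀ → ∃ δ : ℝ, 0 < δ ∧ δ < δ₀ ∧
      ∃ 𝒰 : Set (Set (EuclideanSpace ℝ (Fin 2))), 𝒰.Countable ∧ topSine p ⊆ ⋃₀ 𝒰 ∧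
      (∀ U ∈ 𝒰, δ ≤ diam U ∧ diam U ≤ δ ^ θ) ∧
      ∑' U : 𝒰, ENNReal.ofReal (diam (U : Set (EuclideanSpace ℝ (Fin 2))) ^ s) ≤
        ENNReal.ofReal ε) → 1 + θ / (θ + p) ≤ s := by
    intro s hs
    by_contra! hlt
    set C : ℝ := 1 + 6 ^ (p + 1) / p with hC
    have hC0 : 0 < C := by positivity
    obtain ⟨δ, hδ, hδ1, 𝒰, a1, a2, a3, a4⟩ := hs (1 / (2 * C)) (by positivity) 1 one_pos
    have h1 := ts_lower hp hθ hδ hδ1 hlt.le a1 a2 a3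
    have h2 := h1.trans (mul_le_mul_right a4 (ENNReal.ofReal C))
    rw [← ENNReal.ofReal_mul hC0.le, ENNReal.one_le_ofReal] at h2
    have : C * (1 / (2 * C)) = 1 / 2 := by field_simp
    rw [this] at h2
    norm_num at h2
  have hul : ∀ s : ℝ, (∀ ε : ℝ, 0 < ε → ∃ δ₀ : ℝ, 0 < δ₀ ∧
      ∀ δ : ℝ, 0 < δ → δ < δ₀ →
      ∃ 𝒰 : Set (Set (EuclideanSpace ℝ (Fin 2))), 𝒰.Countable ∧ topSine p ⊆ ⋃₀ 𝒰 ∧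
      (∀ U ∈ 𝒰, δ ≤ diam U ∧ diam U ≤ δ ^ θ) ∧
      ∑' U : 𝒰, ENNReal.ofReal (diam (U : Set (EuclideanSpace ℝ (Fin 2))) ^ s) ≤
        ENNReal.ofReal ε) →
      (∀ ε : ℝ, 0 < ε → ∀ δ₀ : ℝ, 0 < δ₀ → ∃ δ : ℝ, 0 < δ ∧ δ < δ₀ ∧
      ∃ 𝒰 : Set (Set (EuclideanSpace ℝ (Fin 2))), 𝒰.Countable ∧ topSine p ⊆ ⋃₀ 𝒰 ∧
      (∀ U ∈ 𝒰, δ ≤ diam U ∧ diam U ≤ δ ^ θ) ∧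
      ∑' U : 𝒰, ENNReal.ofReal (diam (U : Set (EuclideanSpace ℝ (Fin 2))) ^ s) ≤
        ENNReal.ofReal ε) := by
    intro s hs ε hε δ₀ hδ₀
    obtain ⟨δ₁, h1, h2⟩ := hs ε hε
    have hm : 0 < min δ₀ δ₁ := lt_min hδ₀ h1
    have hm2 : min δ₀ δ₁ / 2 < min δ₀ δ₁ := by linarith
    exact ⟨min δ₀ δ₁ / 2, by linarith, hm2.trans_le (min_le_left _ _),
      h2 _ (by linarith) (hm2.trans_le (min_le_right _ _))⟩
  constructor
  · apply csInf_eq_of_forall_ge_of_forall_gt_exists_lt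
    · exact ⟨1 + θ / (θ + p) + 1, by linarith, hul _ (hup _ (by linarith))⟩
    · rintro s ⟨-, hs⟩
      exact hlow s hs
    · intro w hw
      exact ⟨(1 + θ / (θ + p) + w) / 2, ⟨by linarith, hul _ (hup _ (by linarith))⟩, by linarith⟩
  · apply csInf_eq_of_forall_ge_of_forall_gt_exists_lt
    · exact ⟨1 + θ / (θ + p) + 1, by linarith, hup _ (by linarith)⟩
    · rintro s ⟨-, hs⟩
      exact hlow s (hul s hs)
    · intro w hw
      exact ⟨(1 + θ / (θ + p) + w) / 2, ⟨by linarith, hup _ (by linarith)⟩, by linarith⟩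
end
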